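/- A measurable function F on the unit circle 𝕋 has the form F = f ∘ τ for some measurable function f on Γ if and only if F ∘ σ = F (m-a.e.) for every σ in the covering group 𝔊 of τ. -/

import Mathlib

open MeasureTheory Metric Complex Filter Set
open scoped ENNReal Topology

noncomputable section

/-- `u` is harmonic (real-valued) on an open set `U ⊆ ℂ`: locally the real part of a
holomorphic function. -/
def IsHarmonicOn (u : ℂ → ℝ) (U : Set ℂ) : Prop :=
  ∀ z ∈ U, ∃ r > 0, ball z r ⊆ U ∧ ∃ g : ℂ → ℂ,
    DifferentiableOn ℂ g (ball z r) ∧ ∀ w ∈ ball z r, u w = (g w).re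

/-- An analytic boundary curve: the image of an injective analytic immersion of the
unit circle. -/
def IsAnalyticCurve (C : Set ℂ) : Prop :=
  ∃ γ : ℂ → ℂ, AnalyticOnNhd ℂ γ (sphere (0:ℂ) 1) ∧ Set.InjOn γ (sphere (0:ℂ) 1) ∧
    γ '' (sphere (0:ℂ) 1) = C ∧ ∀ z ∈ sphere (0:ℂ) 1, deriv γ z ≠ 0

/-- Nontangential limit `L` of `g` at a boundary point `ζ` of `Ω`: convergence within
every cone-like approach region of aperture `a > 1`. -/
def NTLim (Ω : Set ℂ) (g : ℂ → ℂ) (ζ : ℂ) (L : ℂ) : Prop :=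
  ∀ a : ℝ, 1 < a →
    Tendsto g (𝓝[{z ∈ Ω | ‖z - ζ‖ < a * infDist z Ωᶜ}] ζ) (𝓝 L)

/-- A bounded finitely connected planar domain `Ω` with analytic boundary components
`Γ 0, …, Γ n` (`Γ 0` the outer one), a base point `w₀ ∈ Ω`, and the family of harmonic
measures `ωm w` (probability measures on the boundary reproducing functions harmonic on
`Ω` and continuous on its closure). -/
structure MCDomain (n : ℕ) where
  Ω : Set ℂ
  Γ : Fin (n+1) → Set ℂ
  w₀ : ℂ
  ωm : ℂ → Measure ℂ
  isOpen : IsOpen Ω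
  conn : IsConnected Ω
  bdd : Bornology.IsBounded Ω
  base_mem : w₀ ∈ Ω
  frontier_eq : frontier Ω = ⋃ j, Γ j
  disj : ∀ j k, j ≠ k → Disjoint (Γ j) (Γ k)
  curve : ∀ j, IsAnalyticCurve (Γ j)
  outer_comp : ∀ j, j ≠ 0 → ∀ ζ ∈ Γ j, ζ ∈ closure (interior (closure (Ω ∪ Γ 0)))
  prob : ∀ w ∈ Ω, IsProbabilityMeasure (ωm w)
  supp : ∀ w ∈ Ω, ωm w (frontier Ω)ᶜ = 0
  dirichlet : ∀ u : ℂ → ℝ, ContinuousOn u (closure Ω) → IsHarmonicOn u Ω →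
    ∀ w ∈ Ω, u w = ∫ ζ, u ζ ∂(ωm w)

variable {n : ℕ}

/-- Harmonic measure at the base point. -/
def MCDomain.ω (D : MCDomain n) : Measure ℂ := D.ωm D.w₀

/-- `H^∞(Γ)`: boundary functions (via nontangential limits a.e.) of bounded analytic
functions on `Ω`. -/
def MCDomain.Hinf (D : MCDomain n) : Set (ℂ → ℂ) :=
  {ψ | ∃ g : ℂ → ℂ, DifferentiableOn ℂ g D.Ω ∧ (∃ C : ℝ, ∀ z ∈ D.Ω, ‖g z‖ ≤ C) ∧
    ∀ᵐ ζ ∂D.ω, NTLim D.Ω g ζ (ψ ζ)}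

/-- `H²(Γ)`: boundary functions of analytic functions on `Ω` such that `|g|²` has a
harmonic majorant. -/
def MCDomain.H2 (D : MCDomain n) : Set (ℂ → ℂ) :=
  {ψ | ∃ g : ℂ → ℂ, DifferentiableOn ℂ g D.Ω ∧
    (∃ h : ℂ → ℝ, IsHarmonicOn h D.Ω ∧ ∀ z ∈ D.Ω, ‖g z‖ ^ 2 ≤ h z) ∧
    ∀ᵐ ζ ∂D.ω, NTLim D.Ω g ζ (ψ ζ)}

/-- `H¹(Γ)`: boundary functions of analytic functions on `Ω` such that `|g|` has a
harmonic majorant. -/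
def MCDomain.H1 (D : MCDomain n) : Set (ℂ → ℂ) :=
  {ψ | ∃ g : ℂ → ℂ, DifferentiableOn ℂ g D.Ω ∧
    (∃ h : ℂ → ℝ, IsHarmonicOn h D.Ω ∧ ∀ z ∈ D.Ω, ‖g z‖ ≤ h z) ∧
    ∀ᵐ ζ ∂D.ω, NTLim D.Ω g ζ (ψ ζ)}

/-- `ψ` is (the boundary function of) an outer function on `Ω` in Royden's sense:
`log|g(w)| = ∫_Γ log|ψ| dω_w` for all `w ∈ Ω`. -/
def MCDomain.IsOuter (D : MCDomain n) (ψ : ℂ → ℂ) : Prop :=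
  ∃ g : ℂ → ℂ, DifferentiableOn ℂ g D.Ω ∧ (∀ᵐ ζ ∂D.ω, NTLim D.Ω g ζ (ψ ζ)) ∧
    ∀ w ∈ D.Ω, Real.log ‖g w‖ = ∫ ζ, Real.log ‖ψ ζ‖ ∂(D.ωm w)

/-- Royden inner function (boundary form): a member of `H^∞(Γ)` whose modulus is
a.e. constant on each boundary component. -/
def MCDomain.IsInner (D : MCDomain n) (φ : ℂ → ℂ) : Prop :=
  φ ∈ D.Hinf ∧ ∀ j, ∃ c : ℝ, ∀ᵐ ζ ∂D.ω, ζ ∈ D.Γ j → ‖φ ζ‖ = c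

/-- Normalized Lebesgue measure `m` on the unit circle in `ℂ`. -/
def circleMeasure : Measure ℂ :=
  (ENNReal.ofReal (2 * Real.pi))⁻¹ •
    Measure.map (fun t : ℝ => Complex.exp (t * Complex.I))
      (volume.restrict (Ioc (0:ℝ) (2 * Real.pi)))

/-- The Poisson (harmonic) measure `dm_z = P_z dm` on the circle, for `z` in the disk. -/
def poissonMeasure (z : ℂ) : Measure ℂ :=
  circleMeasure.withDensity (fun ζ => ENNReal.ofReal ((1 - ‖z‖ ^ 2) / ‖ζ - z‖ ^ 2))

/-- A conformal automorphism of the unit disk, as a globally defined Möbius map. -/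
def IsDiskAut (σ : ℂ → ℂ) : Prop :=
  ∃ c a : ℂ, ‖c‖ = 1 ∧ ‖a‖ < 1 ∧ ∀ z, σ z = c * ((z - a) / (1 - (starRingEnd ℂ) a * z))

/-- `σ` is a deck transformation (an element of the covering group `𝔊`) of `τ`. -/
def IsDeck (τ σ : ℂ → ℂ) : Prop :=
  IsDiskAut σ ∧ ∀ z ∈ ball (0:ℂ) 1, τ (σ z) = τ z

/-- `τ` is an analytic covering map of the unit disk onto `Ω` with `τ 0 = w₀` and
`τ'(0) > 0`. -/
structure IsCoveringOfDisk (Ω : Set ℂ) (w₀ : ℂ) (τ : ℂ → ℂ) : Prop where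
  diff : DifferentiableOn ℂ τ (ball 0 1)
  mapsTo : ∀ z ∈ ball (0:ℂ) 1, τ z ∈ Ω
  surj : Ω ⊆ τ '' (ball 0 1)
  base : τ 0 = w₀
  deriv_pos : (deriv τ 0).im = 0 ∧ 0 < (deriv τ 0).re
  evenly : ∀ w ∈ Ω, ∃ r > 0, ball w r ⊆ Ω ∧ ∀ z ∈ ball (0:ℂ) 1, τ z ∈ ball w r →
    BijOn τ (connectedComponentIn (ball 0 1 ∩ τ ⁻¹' ball w r) z) (ball w r)

/-- `τb` is the (measurable, a.e.-defined via nontangential limits) boundary function of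
`τ` on the unit circle, mapping into the boundary of `Ω`. -/
def IsBoundaryMap (Ω : Set ℂ) (τ τb : ℂ → ℂ) : Prop :=
  Measurable τb ∧
    ∀ᵐ ζ ∂circleMeasure, NTLim (ball 0 1) τ ζ (τb ζ) ∧ τb ζ ∈ frontier Ω

/-- A holomorphic function with a continuous local right inverse has nonzero derivative. -/
theorem deriv_ne_zero_of_eventually_rightInverse {f g : ℂ → ℂ} {w : ℂ}
    (hf : AnalyticAt ℂ f (g w)) (hg : ∀ᶠ y in 𝓝 w, ContinuousAt g y)
    (h : ∀ᶠ y in 𝓝 w, f (g y) = y) : deriv f (g w) ≠ 0 := by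
  have hgw : Tendsto g (𝓝 w) (𝓝 (g w)) := hg.self_of_nhds
  have hw : f (g w) = w := h.self_of_nhds
  rcases hf.deriv.eventually_eq_zero_or_eventually_ne_zero with h0 | h1
  · exfalso
    have hc : ∀ᶠ z in 𝓝 (g w), f z = w := by
      obtain ⟨r, hr, hball⟩ := Metric.eventually_nhds_iff_ball.1
        (h0.and hf.eventually_analyticAt)
      refine Metric.eventually_nhds_iff_ball.2 ⟨r, hr, fun z hz => ?_⟩
      rw [← hw]
      refine isOpen_ball.is_const_of_deriv_eq_zero (convex_ball (g w) r).isPreconnected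
        (fun y hy => (hball y hy).2.differentiableAt.differentiableWithinAt)
        (fun y hy => (hball y hy).1) hz (mem_ball_self hr)
    have h2 : ∀ᶠ y in 𝓝 w, y = w := by
      filter_upwards [h, hgw.eventually hc] with y h1 h2
      rw [← h1, h2]
    have h3 : ∀ᶠ y in 𝓝[≠] w, y = w := h2.filter_mono nhdsWithin_le_nhds
    obtain ⟨y, hy1, hy2⟩ := (h3.and self_mem_nhdsWithin).exists
    exact hy2 hy1
  · have hg' : DifferentiableAt ℂ g w := by
      refine (Complex.analyticAt_of_differentiable_on_punctured_nhds_of_continuousAt ?_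
        hgw).differentiableAt
      have h1' : ∀ᶠ y in 𝓝 w, g y ≠ g w → deriv f (g y) ≠ 0 :=
        hgw.eventually (eventually_nhdsWithin_iff.1 h1)
      refine eventually_nhdsWithin_iff.2 ?_
      filter_upwards [h1', hg, h.eventually_nhds, hgw.eventually hf.eventually_analyticAt]
        with y hy1 hy2 hy3 hy4 hne
      have hd : deriv f (g y) ≠ 0 := by
        refine hy1 fun he => hne ?_
        rw [mem_singleton_iff, ← hy3.self_of_nhds, he, hw]
      exact (HasDerivAt.of_local_left_inverse hy2 hy4.differentiableAt.hasDerivAt hd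
        hy3).differentiableAt
    intro h0
    have hc : HasDerivAt (f ∘ g) (deriv f (g w) * deriv g w) w :=
      hf.differentiableAt.hasDerivAt.comp w hg'.hasDerivAt
    have hid : HasDerivAt (f ∘ g) 1 w := (hasDerivAt_id w).congr_of_eventuallyEq h
    have := hc.unique hid
    simp [h0] at this

/-- A continuous lift of a holomorphic function through a holomorphic function with nonzero
derivative is holomorphic. -/
theorem differentiableAt_of_lift {f s φ : ℂ → ℂ} {a : ℂ} (hf : AnalyticAt ℂ f (s a))
    (hd : deriv f (s a) ≠ 0) (hs : ContinuousAt s a) (hφ : DifferentiableAt ℂ φ a)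
    (h : ∀ᶠ y in 𝓝 a, f (s y) = φ y) : DifferentiableAt ℂ s a := by
  have hst : HasStrictDerivAt f (deriv f (s a)) (s a) := hf.hasStrictDerivAt
  set e := hst.localInverse f _ _ hd with he
  have hleft : ∀ᶠ z in 𝓝 (s a), e (f z) = z := hst.eventually_left_inverse hd
  have hed : DifferentiableAt ℂ e (f (s a)) := (hst.to_localInverse hd).hasDerivAt.differentiableAt
  have ha : f (s a) = φ a := h.self_of_nhds
  rw [ha] at hed
  refine (hed.comp a hφ).congr_of_eventuallyEq ?_
  filter_upwards [h, hs.eventually hleft] with y h1 h2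
  rw [Function.comp_apply, ← h1, h2]

namespace IsCoveringOfDisk

variable {Ω : Set ℂ} {w₀ : ℂ} {τ : ℂ → ℂ}

theorem analyticAt (hτ : IsCoveringOfDisk Ω w₀ τ) {z : ℂ} (hz : z ∈ ball (0 : ℂ) 1) :
    AnalyticAt ℂ τ z :=
  hτ.diff.analyticAt (isOpen_ball.mem_nhds hz)

theorem isOpen_image (hτ : IsCoveringOfDisk Ω w₀ τ) {s : Set ℂ} (hs : s ⊆ ball 0 1)
    (hso : IsOpen s) : IsOpen (τ '' s) := by
  have hA : AnalyticOnNhd ℂ τ (ball 0 1) := fun z hz => hτ.analyticAt hz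
  rcases hA.is_constant_or_isOpen (convex_ball (0 : ℂ) 1).isPreconnected with ⟨w, hw⟩ | h
  · exfalso
    have h0 : deriv τ 0 = 0 := by
      have : τ =ᶠ[𝓝 0] fun _ => w := by
        filter_upwards [ball_mem_nhds (0 : ℂ) one_pos] with z hz using hw z hz
      rw [this.deriv_eq, deriv_const]
    have := hτ.deriv_pos.2
    simp [h0] at this
  · exact h s hs hso

/-- The map of the disk into the plane induced by `τ` is a covering map over `Ω`. -/
theorem isCoveringMapOn (hτ : IsCoveringOfDisk Ω w₀ τ) :
    IsCoveringMapOn (fun z : ball (0 : ℂ) 1 => τ z) Ω := by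
  have hcont : Continuous (fun z : ball (0 : ℂ) 1 => τ z) := hτ.diff.continuousOn.domRestrict
  have key : ∀ w : Ω, ∃ t : Bundle.Trivialization ((fun z : ball (0 : ℂ) 1 => τ z) ⁻¹' {(w : ℂ)})
      (fun z : ball (0 : ℂ) 1 => τ z), DiscreteTopology
        ((fun z : ball (0 : ℂ) 1 => τ z) ⁻¹' {(w : ℂ)}) ∧ (w : ℂ) ∈ t.baseSet := by
    intro w
    obtain ⟨r, hr, hrΩ, hbij⟩ := hτ.evenly w w.2
    set p : ball (0 : ℂ) 1 → ℂ := fun z => τ z with hp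
    set comp : ℂ → Set ℂ := connectedComponentIn (ball 0 1 ∩ τ ⁻¹' ball (w : ℂ) r) with hcomp
    have hOpre : IsOpen (ball (0 : ℂ) 1 ∩ τ ⁻¹' ball (w : ℂ) r) :=
      hτ.diff.continuousOn.isOpen_inter_preimage isOpen_ball isOpen_ball
    have hcompO : ∀ z, IsOpen (comp z) := fun z => hOpre.connectedComponentIn
    have hcompS : ∀ z, comp z ⊆ ball (0 : ℂ) 1 := fun z =>
      (connectedComponentIn_subset _ z).trans inter_subset_left
    have hw_mem : (w : ℂ) ∈ ball (w : ℂ) r := mem_ball_self hr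
    have hfib : ∀ z : p ⁻¹' {(w : ℂ)}, τ (z : ball (0 : ℂ) 1) = w := fun z => z.2
    have hself : ∀ z : p ⁻¹' {(w : ℂ)},
        ((z : ball (0 : ℂ) 1) : ℂ) ∈ ball (0 : ℂ) 1 ∩ τ ⁻¹' ball (w : ℂ) r := fun z =>
      ⟨z.1.2, by rw [mem_preimage, hfib z]; exact hw_mem⟩
    have hbij' : ∀ z : p ⁻¹' {(w : ℂ)}, BijOn τ (comp z.1) (ball (w : ℂ) r) := fun z =>
      hbij _ (hself z).1 (hself z).2
    let U : p ⁻¹' {(w : ℂ)} → Set (ball (0 : ℂ) 1) := fun i => Subtype.val ⁻¹' comp i.1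
    have hUO : ∀ i, IsOpen (U i) := fun i => (hcompO _).preimage continuous_subtype_val
    have hUself : ∀ i, i.1 ∈ U i := fun i => mem_connectedComponentIn (hself i)
    have hinj : ∀ i, (U i).InjOn p := fun i x hx y hy h =>
      Subtype.ext ((hbij' i).injOn hx hy h)
    have hsurj : ∀ i, (U i).SurjOn p (ball (w : ℂ) r) := by
      intro i y hy
      obtain ⟨x, hx, rfl⟩ := (hbij' i).surjOn hy
      exact ⟨⟨x, hcompS _ hx⟩, hx, rfl⟩
    have hdisc : DiscreteTopology (p ⁻¹' {(w : ℂ)}) := by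
      refine discreteTopology_iff_isOpen_singleton.2 fun i => ?_
      refine isOpen_induced_iff.2 ⟨U i, hUO i, ?_⟩
      ext j
      refine ⟨fun hj => Subtype.ext (hinj i hj (hUself i) ?_), ?_⟩
      · exact (hfib j).trans (hfib i).symm
      · rintro rfl; exact hUself j
    obtain ⟨z₁, hz₁, hz₁w⟩ := hτ.surj w.2
    have : Nonempty (p ⁻¹' {(w : ℂ)}) := ⟨⟨⟨z₁, hz₁⟩, hz₁w⟩⟩
    have : Nonempty (ℂ → ball (0 : ℂ) 1) := ⟨fun _ => ⟨z₁, hz₁⟩⟩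
    refine ⟨IsOpen.trivializationDiscrete (f := p) U (ball (w : ℂ) r) isOpen_ball ?_ hinj hsurj
      ?_ ?_, hdisc, hw_mem⟩
    · intro i W hW
      refine ⟨fun h => (h.preimage hcont).inter (hUO i), fun h => ?_⟩
      have himg : W = τ '' (Subtype.val '' (p ⁻¹' W ∩ U i)) := by
        ext y
        constructor
        · intro hy
          obtain ⟨x, hx, rfl⟩ := hsurj i (hW hy)
          exact ⟨x, ⟨x, ⟨hy, hx⟩, rfl⟩, rfl⟩
        · rintro ⟨_, ⟨x, hx, rfl⟩, rfl⟩
          exact hx.1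
      rw [himg]
      refine hτ.isOpen_image ?_ (isOpen_ball.isOpenMap_subtype_val _ h)
      rintro _ ⟨x, -, rfl⟩
      exact x.2
    · intro i j hij
      refine disjoint_left.2 fun x hxi hxj => hij ?_
      have h1 : comp i.1 = comp x := connectedComponentIn_eq hxi
      have h2 : comp j.1 = comp x := connectedComponentIn_eq hxj
      have h3 : j.1 ∈ U i := by
        have : j.1 ∈ U j := hUself j
        change ((j.1 : ball (0 : ℂ) 1) : ℂ) ∈ comp i.1
        rw [h1, ← h2]
        exact this
      exact Subtype.ext (hinj i (hUself i) h3 ((hfib i).trans (hfib j).symm))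
    · intro x hx
      have hb := hbij x x.2 hx
      obtain ⟨y, hy, hyw⟩ := hb.surjOn hw_mem
      refine mem_iUnion.2 ⟨⟨⟨y, hcompS _ hy⟩, hyw⟩, ?_⟩
      change (x : ℂ) ∈ comp y
      have : comp x = comp y := connectedComponentIn_eq hy
      rw [← this]
      exact mem_connectedComponentIn ⟨x.2, hx⟩
  intro w hw
  obtain ⟨t, hd, ht⟩ := key ⟨w, hw⟩
  exact (IsEvenlyCovered.of_trivialization ht).to_isEvenlyCovered_preimage

end IsCoveringOfDisk

/-- The Möbius transformation `z ↦ (z - a) / (1 - conj a * z)`. -/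
def diskMoebius (a z : ℂ) : ℂ := (z - a) / (1 - (starRingEnd ℂ) a * z)

theorem diskMoebius_denom_ne_zero {a z : ℂ} (ha : ‖a‖ < 1) (hz : ‖z‖ ≤ 1) :
    1 - (starRingEnd ℂ) a * z ≠ 0 := by
  intro h
  have h1 : (starRingEnd ℂ) a * z = 1 := (sub_eq_zero.1 h).symm
  have h2 : ‖a‖ * ‖z‖ = 1 := by
    rw [← RCLike.norm_conj a, ← norm_mul, h1, norm_one]
  nlinarith [norm_nonneg a, norm_nonneg z]

theorem one_sub_norm_diskMoebius_sq {a z : ℂ} (ha : ‖a‖ < 1) (hz : ‖z‖ ≤ 1) :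
    1 - ‖diskMoebius a z‖ ^ 2 =
      (1 - ‖a‖ ^ 2) * (1 - ‖z‖ ^ 2) / ‖1 - (starRingEnd ℂ) a * z‖ ^ 2 := by
  have hd := diskMoebius_denom_ne_zero ha hz
  have hd' : ‖1 - (starRingEnd ℂ) a * z‖ ^ 2 ≠ 0 := pow_ne_zero 2 (norm_ne_zero_iff.2 hd)
  rw [diskMoebius, norm_div, div_pow, eq_div_iff hd', sub_mul, div_mul_cancel₀ _ hd']
  simp only [← Complex.normSq_eq_norm_sq, Complex.normSq_apply]
  simp
  ring

theorem norm_diskMoebius_lt_one {a z : ℂ} (ha : ‖a‖ < 1) (hz : ‖z‖ < 1) :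
    ‖diskMoebius a z‖ < 1 := by
  have h := one_sub_norm_diskMoebius_sq ha hz.le
  have hd := diskMoebius_denom_ne_zero ha hz.le
  have : 0 < (1 - ‖a‖ ^ 2) * (1 - ‖z‖ ^ 2) / ‖1 - (starRingEnd ℂ) a * z‖ ^ 2 := by
    have h1 : 0 < 1 - ‖a‖ ^ 2 := by nlinarith [norm_nonneg a]
    have h2 : 0 < 1 - ‖z‖ ^ 2 := by nlinarith [norm_nonneg z]
    have h3 := norm_pos_iff.2 hd
    positivity
  nlinarith [norm_nonneg (diskMoebius a z)]

theorem norm_diskMoebius_eq_one {a z : ℂ} (ha : ‖a‖ < 1) (hz : ‖z‖ = 1) :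
    ‖diskMoebius a z‖ = 1 := by
  have h := one_sub_norm_diskMoebius_sq ha hz.le
  rw [hz] at h
  simp only [one_pow, sub_self, mul_zero, zero_div] at h
  nlinarith [norm_nonneg (diskMoebius a z)]

theorem differentiableAt_diskMoebius {a z : ℂ} (ha : ‖a‖ < 1) (hz : ‖z‖ ≤ 1) :
    DifferentiableAt ℂ (diskMoebius a) z := by
  unfold diskMoebius
  exact (by fun_prop : DifferentiableAt ℂ (fun z => z - a) z).fun_div (by fun_prop)
    (diskMoebius_denom_ne_zero ha hz)

theorem diskMoebius_neg_diskMoebius {a z : ℂ} (ha : ‖a‖ < 1) (hz : ‖z‖ ≤ 1) :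
    diskMoebius (-a) (diskMoebius a z) = z := by
  have hd := diskMoebius_denom_ne_zero ha hz
  have ha2 := diskMoebius_denom_ne_zero ha ha.le
  simp only [diskMoebius, map_neg]
  have h1 : (z - a) / (1 - (starRingEnd ℂ) a * z) - -a
      = z * (1 - (starRingEnd ℂ) a * a) / (1 - (starRingEnd ℂ) a * z) := by
    rw [eq_div_iff hd, sub_mul, div_mul_cancel₀ _ hd]
    ring
  have h2 : 1 - -(starRingEnd ℂ) a * ((z - a) / (1 - (starRingEnd ℂ) a * z))
      = (1 - (starRingEnd ℂ) a * a) / (1 - (starRingEnd ℂ) a * z) := by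
    rw [eq_div_iff hd, sub_mul, mul_assoc, div_mul_cancel₀ _ hd]
    ring
  rw [h1, h2, div_div_div_cancel_right₀ hd, mul_div_cancel_right₀ _ ha2]

theorem diskMoebius_diskMoebius_neg {a z : ℂ} (ha : ‖a‖ < 1) (hz : ‖z‖ ≤ 1) :
    diskMoebius a (diskMoebius (-a) z) = z := by
  simpa using diskMoebius_neg_diskMoebius (a := -a) (by simpa using ha) hz

theorem IsDiskAut.exists_eq {σ : ℂ → ℂ} (hσ : IsDiskAut σ) :
    ∃ c a : ℂ, ‖c‖ = 1 ∧ ‖a‖ < 1 ∧ σ = fun z => c * diskMoebius a z := by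
  obtain ⟨c, a, hc, ha, h⟩ := hσ
  exact ⟨c, a, hc, ha, funext h⟩

theorem IsDiskAut.mapsTo_ball {σ : ℂ → ℂ} (hσ : IsDiskAut σ) :
    MapsTo σ (ball 0 1) (ball 0 1) := by
  obtain ⟨c, a, hc, ha, rfl⟩ := hσ.exists_eq
  intro z hz
  simp only [mem_ball_zero_iff] at hz ⊢
  rw [norm_mul, hc, one_mul]
  exact norm_diskMoebius_lt_one ha hz

theorem IsDiskAut.differentiableAt {σ : ℂ → ℂ} (hσ : IsDiskAut σ) {z : ℂ} (hz : ‖z‖ ≤ 1) :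
    DifferentiableAt ℂ σ z := by
  obtain ⟨c, a, hc, ha, rfl⟩ := hσ.exists_eq
  exact (differentiableAt_diskMoebius ha hz).const_mul c

/-- A biholomorphic self-map of the unit disk is a Möbius transformation. -/
theorem exists_isDiskAut_eqOn {g h : ℂ → ℂ} (hg : DifferentiableOn ℂ g (ball 0 1))
    (hh : DifferentiableOn ℂ h (ball 0 1)) (hgm : MapsTo g (ball 0 1) (ball 0 1))
    (hhm : MapsTo h (ball 0 1) (ball 0 1)) (hgh : ∀ z ∈ ball (0 : ℂ) 1, g (h z) = z)
    (hhg : ∀ z ∈ ball (0 : ℂ) 1, h (g z) = z) :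
    ∃ σ, IsDiskAut σ ∧ EqOn σ g (ball 0 1) := by
  have h0 : (0 : ℂ) ∈ ball (0 : ℂ) 1 := mem_ball_self one_pos
  set b := h 0 with hb
  have hb1 : ‖b‖ < 1 := mem_ball_zero_iff.1 (hhm h0)
  have hb1' : ‖-b‖ < 1 := by simpa using hb1
  have hm : ∀ {a : ℂ}, ‖a‖ < 1 → MapsTo (diskMoebius a) (ball 0 1) (ball 0 1) := fun ha z hz =>
    mem_ball_zero_iff.2 (norm_diskMoebius_lt_one ha (mem_ball_zero_iff.1 hz))
  have hmd : ∀ {a : ℂ}, ‖a‖ < 1 → DifferentiableOn ℂ (diskMoebius a) (ball 0 1) := fun ha z hz =>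
    (differentiableAt_diskMoebius ha (mem_ball_zero_iff.1 hz).le).differentiableWithinAt
  set G := g ∘ diskMoebius (-b) with hG
  set H := diskMoebius b ∘ h with hH
  have hGd : DifferentiableOn ℂ G (ball 0 1) := hg.comp (hmd hb1') (hm hb1')
  have hHd : DifferentiableOn ℂ H (ball 0 1) := (hmd hb1).comp hh hhm
  have hGm : MapsTo G (ball 0 1) (ball 0 1) := hgm.comp (hm hb1')
  have hHm : MapsTo H (ball 0 1) (ball 0 1) := (hm hb1).comp hhm
  have hG0 : G 0 = 0 := by
    have : diskMoebius (-b) 0 = b := by simp [diskMoebius]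
    rw [hG, Function.comp_apply, this, hb, hgh 0 h0]
  have hH0 : H 0 = 0 := by simp [hH, diskMoebius, ← hb]
  have hHG : ∀ z ∈ ball (0 : ℂ) 1, H (G z) = z := by
    intro z hz
    simp only [hH, hG, Function.comp_apply]
    rw [hhg _ (hm hb1' hz), diskMoebius_diskMoebius_neg hb1 (mem_ball_zero_iff.1 hz).le]
  have hnorm : ∀ z ∈ ball (0 : ℂ) 1, ‖G z‖ = ‖z‖ := by
    intro z hz
    refine le_antisymm (norm_le_norm_of_mapsTo_ball hGd (hGm.mono_right ball_subset_closedBall)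
      hG0 (mem_ball_zero_iff.1 hz)) ?_
    have := norm_le_norm_of_mapsTo_ball hHd (hHm.mono_right ball_subset_closedBall) hH0
      (mem_ball_zero_iff.1 (hGm hz))
    rwa [hHG z hz] at this
  have hhalf : (1 / 2 : ℂ) ∈ ball (0 : ℂ) 1 := by
    rw [mem_ball_zero_iff]; norm_num
  obtain ⟨C, hC, hCG⟩ := affine_of_mapsTo_ball_of_exists_norm_dslope_eq_div' hGd
    (R₂ := 1) (by rw [hG0]; exact hGm.mono_right ball_subset_closedBall)
    ⟨1 / 2, hhalf, by
      rw [dslope_of_ne _ (by norm_num), slope_def_module, hG0, sub_zero, sub_zero, norm_smul,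
        hnorm _ hhalf]
      norm_num⟩
  refine ⟨fun z => C * diskMoebius b z, ⟨C, b, by simpa using hC, hb1, fun z => rfl⟩, ?_⟩
  intro z hz
  have h1 := hCG (hm hb1 hz)
  simp only [hG, Function.comp_apply] at h1
  rw [diskMoebius_neg_diskMoebius hb1 (mem_ball_zero_iff.1 hz).le] at h1
  rw [h1, ← Function.comp_apply (f := g), ← hG, hG0]
  simp [mul_comm]

namespace IsCoveringOfDisk

variable {Ω : Set ℂ} {w₀ : ℂ} {τ : ℂ → ℂ}

/-- Continuous maps from convex open sets into `Ω` lift through `τ`. -/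
theorem exists_lift (hτ : IsCoveringOfDisk Ω w₀ τ) {A : Set ℂ} (hA : Convex ℝ A)
    (hAo : IsOpen A) {φ : ℂ → ℂ} (hφ : ContinuousOn φ A) (hφm : MapsTo φ A Ω) {a z : ℂ}
    (ha : a ∈ A) (hz : z ∈ ball (0 : ℂ) 1) (haz : τ z = φ a) :
    ∃ s : ℂ → ℂ, ContinuousOn s A ∧ MapsTo s A (ball 0 1) ∧ s a = z ∧
      ∀ x ∈ A, τ (s x) = φ x := by
  have : ContractibleSpace A := hA.contractibleSpace ⟨a, ha⟩
  have : LocallyPathConnectedSpace A := hAo.locallyPathConnectedSpace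
  obtain ⟨F, ⟨hF1, hF2⟩, -⟩ := hτ.isCoveringMapOn.existsUnique_continuousMap_lifts
    (A := A) ⟨fun x : A => φ x, hφ.domRestrict⟩ (a₀ := ⟨a, ha⟩) (e₀ := ⟨z, hz⟩) haz
    (fun x => hφm x.2)
  classical
  refine ⟨fun x => if hx : x ∈ A then F ⟨x, hx⟩ else 0, ?_, ?_, ?_, ?_⟩
  · rw [continuousOn_iff_continuous_domRestrict]
    convert continuous_subtype_val.comp F.continuous using 1
    ext x
    simp [x.2]
  · intro x hx
    simp only [hx, dif_pos]
    exact (F ⟨x, hx⟩).2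
  · simp [ha, hF1]
  · intro x hx
    simp only [hx, dif_pos]
    exact congrFun hF2 ⟨x, hx⟩

/-- Two lifts through `τ` of the same map on a preconnected set agree if they agree at a
point. -/
theorem eqOn_of_lift (hτ : IsCoveringOfDisk Ω w₀ τ) {X : Type*} [TopologicalSpace X]
    {A : Set X} (hA : IsPreconnected A)
    {s₁ s₂ : X → ℂ} (h₁ : ContinuousOn s₁ A) (h₂ : ContinuousOn s₂ A)
    (m₁ : MapsTo s₁ A (ball 0 1)) (m₂ : MapsTo s₂ A (ball 0 1))
    (h : ∀ x ∈ A, τ (s₁ x) = τ (s₂ x)) {a : X} (ha : a ∈ A) (haa : s₁ a = s₂ a) :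
    EqOn s₁ s₂ A := by
  have hpre : (fun z : ball (0 : ℂ) 1 => τ z) ⁻¹' Ω = univ :=
    eq_univ_of_forall fun z => hτ.mapsTo z z.2
  have hcov := hτ.isCoveringMapOn.isCoveringMap_restrictPreimage
  have : PreconnectedSpace A := isPreconnected_iff_preconnectedSpace.1 hA
  let g : ∀ s : X → ℂ, MapsTo s A (ball 0 1) → A →
      (fun z : ball (0 : ℂ) 1 => τ z) ⁻¹' Ω := fun s m x =>
    ⟨⟨s x, m x.2⟩, hτ.mapsTo _ (m x.2)⟩
  have hgc : ∀ s m, ContinuousOn s A → Continuous (g s m) := fun s m hs =>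
    (hs.domRestrict.subtype_mk _).subtype_mk _
  have := hcov.eq_of_comp_eq (hgc s₁ m₁ h₁) (hgc s₂ m₂ h₂) (by
    ext x
    exact h x x.2) ⟨a, ha⟩ (Subtype.ext (Subtype.ext haa))
  intro x hx
  exact congrArg Subtype.val (congrArg Subtype.val (congrFun this ⟨x, hx⟩))

theorem deriv_ne_zero (hτ : IsCoveringOfDisk Ω w₀ τ) {z : ℂ} (hz : z ∈ ball (0 : ℂ) 1) :
    deriv τ z ≠ 0 := by
  obtain ⟨r, hr, hrΩ, -⟩ := hτ.evenly _ (hτ.mapsTo z hz)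
  obtain ⟨s, hs, -, hsz, hsτ⟩ := hτ.exists_lift (convex_ball (τ z) r) isOpen_ball
    (φ := id) continuousOn_id hrΩ (mem_ball_self hr) hz rfl
  have hnhds := ball_mem_nhds (τ z) hr
  have := deriv_ne_zero_of_eventually_rightInverse (f := τ) (g := s) (w := τ z)
    (by rw [hsz]; exact hτ.analyticAt hz)
    (by filter_upwards [hnhds] with y hy using hs.continuousAt (isOpen_ball.mem_nhds hy))
    (by filter_upwards [hnhds] with y hy using hsτ y hy)
  rwa [hsz] at this

theorem differentiableOn_lift (hτ : IsCoveringOfDisk Ω w₀ τ) {A : Set ℂ} (hA : IsOpen A)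
    {φ s : ℂ → ℂ} (hφ : DifferentiableOn ℂ φ A) (hs : ContinuousOn s A)
    (hsm : MapsTo s A (ball 0 1)) (h : ∀ x ∈ A, τ (s x) = φ x) : DifferentiableOn ℂ s A := by
  intro x hx
  have hn := hA.mem_nhds hx
  exact (differentiableAt_of_lift (hτ.analyticAt (hsm hx)) (hτ.deriv_ne_zero (hsm hx))
    (hs.continuousAt hn) (hφ.differentiableAt hn)
    (by filter_upwards [hn] with y hy using h y hy)).differentiableWithinAt

/-- Deck transformations act transitively on the fibers of `τ`. -/
theorem exists_isDeck (hτ : IsCoveringOfDisk Ω w₀ τ) {z₁ z₂ : ℂ} (h₁ : z₁ ∈ ball (0 : ℂ) 1)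
    (h₂ : z₂ ∈ ball (0 : ℂ) 1) (h : τ z₁ = τ z₂) : ∃ σ, IsDeck τ σ ∧ σ z₁ = z₂ := by
  have hcv := convex_ball (0 : ℂ) 1
  have hm : MapsTo τ (ball 0 1) Ω := hτ.mapsTo
  obtain ⟨g, hg, hgm, hg1, hgτ⟩ := hτ.exists_lift hcv isOpen_ball hτ.diff.continuousOn hm h₁ h₂
    h.symm
  obtain ⟨k, hk, hkm, hk2, hkτ⟩ := hτ.exists_lift hcv isOpen_ball hτ.diff.continuousOn hm h₂ h₁ h
  have hgk : ∀ z ∈ ball (0 : ℂ) 1, g (k z) = z :=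
    hτ.eqOn_of_lift hcv.isPreconnected (hg.comp hk hkm) continuousOn_id (hgm.comp hkm)
      (mapsTo_id _) (fun z hz => by simp [hgτ _ (hkm hz), hkτ z hz]) h₂ (by simp [hk2, hg1])
  have hkg : ∀ z ∈ ball (0 : ℂ) 1, k (g z) = z :=
    hτ.eqOn_of_lift hcv.isPreconnected (hk.comp hg hgm) continuousOn_id (hkm.comp hgm)
      (mapsTo_id _) (fun z hz => by simp [hkτ _ (hgm hz), hgτ z hz]) h₁ (by simp [hk2, hg1])
  obtain ⟨σ, hσ, hσg⟩ := exists_isDiskAut_eqOn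
    (hτ.differentiableOn_lift isOpen_ball hτ.diff hg hgm hgτ)
    (hτ.differentiableOn_lift isOpen_ball hτ.diff hk hkm hkτ) hgm hkm hgk hkg
  exact ⟨σ, ⟨hσ, fun z hz => by rw [hσg hz, hgτ z hz]⟩, by rw [hσg h₁, hg1]⟩

/-- Countably many deck transformations suffice to act transitively on the fibers of `τ`. -/
theorem exists_countable_isDeck (hτ : IsCoveringOfDisk Ω w₀ τ) :
    ∃ S : Set (ℂ → ℂ), S.Countable ∧ (∀ σ ∈ S, IsDeck τ σ) ∧
      ∀ z₁ ∈ ball (0 : ℂ) 1, ∀ z₂ ∈ ball (0 : ℂ) 1, τ z₁ = τ z₂ → ∃ σ ∈ S, σ z₁ = z₂ := by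
  have h0 : (0 : ℂ) ∈ ball (0 : ℂ) 1 := mem_ball_self one_pos
  let fiber := (fun z : ball (0 : ℂ) 1 => τ z) ⁻¹' {τ 0}
  have hdisc : DiscreteTopology fiber :=
    (hτ.isCoveringMapOn _ (hτ.mapsTo 0 h0)).discreteTopology_fiber
  have hcount : Countable fiber := TopologicalSpace.separableSpace_iff_countable.1 inferInstance
  have hex : ∀ p : fiber, ∃ σ, IsDeck τ σ ∧ σ 0 = p.1 := fun p =>
    hτ.exists_isDeck h0 p.1.2 (p.2 : τ p.1 = τ 0).symm
  choose d hd hd0 using hex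
  refine ⟨range d, countable_range d, ?_, ?_⟩
  · rintro _ ⟨p, rfl⟩
    exact hd p
  · intro z₁ hz₁ z₂ hz₂ h
    obtain ⟨σ, hσ, hσz⟩ := hτ.exists_isDeck hz₁ hz₂ h
    let p : fiber := ⟨⟨σ 0, hσ.1.mapsTo_ball h0⟩, hσ.2 0 h0⟩
    have hc : ∀ {ρ : ℂ → ℂ}, IsDeck τ ρ → ContinuousOn ρ (ball 0 1) := fun hρ z hz =>
      (hρ.1.differentiableAt (mem_ball_zero_iff.1 hz).le).continuousAt.continuousWithinAt
    have heq : EqOn (d p) σ (ball 0 1) :=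
      hτ.eqOn_of_lift (convex_ball (0 : ℂ) 1).isPreconnected (hc (hd p)) (hc hσ)
        (hd p).1.mapsTo_ball hσ.1.mapsTo_ball
        (fun z hz => by rw [(hd p).2 z hz, hσ.2 z hz]) h0 (hd0 p)
    exact ⟨d p, mem_range_self p, by rw [heq hz₁, hσz]⟩

end IsCoveringOfDisk

/-- The **Schwarz-Pick lemma** at the center of a disk. -/
theorem norm_deriv_le_one_sub_sq_div {f : ℂ → ℂ} {c : ℂ} {R : ℝ} (hR : 0 < R)
    (hf : DifferentiableOn ℂ f (ball c R)) (hm : MapsTo f (ball c R) (ball 0 1)) :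
    ‖deriv f c‖ ≤ (1 - ‖f c‖ ^ 2) / R := by
  have hc : c ∈ ball c R := mem_ball_self hR
  set a := f c with ha
  have ha1 : ‖a‖ < 1 := mem_ball_zero_iff.1 (hm hc)
  have hfc : DifferentiableAt ℂ f c := hf.differentiableAt (isOpen_ball.mem_nhds hc)
  have hpos : 0 < 1 - ‖a‖ ^ 2 := by nlinarith [norm_nonneg a]
  have hconj : (1 : ℂ) - (starRingEnd ℂ) a * a = ((1 - ‖a‖ ^ 2 : ℝ) : ℂ) := by
    rw [mul_comm, Complex.mul_conj, Complex.normSq_eq_norm_sq]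
    push_cast
    ring
  have hma : HasDerivAt (diskMoebius a) (((1 - ‖a‖ ^ 2 : ℝ) : ℂ)⁻¹) a := by
    have hne := diskMoebius_denom_ne_zero ha1 ha1.le
    have h1 : HasDerivAt (fun z : ℂ => z - a) 1 a := (hasDerivAt_id a).sub_const a
    have h2 : HasDerivAt (fun z : ℂ => 1 - (starRingEnd ℂ) a * z)
        (-((starRingEnd ℂ) a * 1)) a := ((hasDerivAt_id a).const_mul _).const_sub 1
    refine (h1.fun_div h2 hne).congr_deriv ?_
    rw [sub_self, zero_mul, sub_zero, one_mul, ← hconj, sq, div_mul_cancel_left₀ hne]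
  have hcomp : HasDerivAt (diskMoebius a ∘ f) (((1 - ‖a‖ ^ 2 : ℝ) : ℂ)⁻¹ * deriv f c) c :=
    HasDerivAt.comp c (h₂ := diskMoebius a) hma hfc.hasDerivAt
  have hd : DifferentiableOn ℂ (diskMoebius a ∘ f) (ball c R) := fun z hz =>
    ((differentiableAt_diskMoebius ha1 (mem_ball_zero_iff.1 (hm hz)).le).comp z
      (hf.differentiableAt (isOpen_ball.mem_nhds hz))).differentiableWithinAt
  have h0 : (diskMoebius a ∘ f) c = 0 := by simp [diskMoebius, ← ha]
  have := norm_deriv_le_div_of_mapsTo_ball (R₂ := 1) hd (by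
    rw [h0]
    exact fun z hz => ball_subset_closedBall
      (mem_ball_zero_iff.2 (norm_diskMoebius_lt_one ha1 (mem_ball_zero_iff.1 (hm hz))))) hR
  rw [hcomp.deriv, norm_mul, norm_inv, Complex.norm_real, Real.norm_of_nonneg hpos.le,
    inv_mul_le_iff₀ hpos] at this
  rwa [mul_one_div] at this

/-- The open upper half of the disk of radius `R` centered at the origin. -/
def halfDisk (R : ℝ) : Set ℂ := {z | z ∈ ball (0 : ℂ) R ∧ 0 < z.im}

theorem isOpen_halfDisk (R : ℝ) : IsOpen (halfDisk R) :=
  isOpen_ball.inter (isOpen_lt continuous_const Complex.continuous_im)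

theorem convex_halfDisk (R : ℝ) : Convex ℝ (halfDisk R) :=
  (convex_ball (0 : ℂ) R).inter (convex_halfSpace_im_gt 0)

/-- A lower bound by a harmonic barrier for the modulus of a holomorphic function on a half disk
whose modulus tends to `1` at the diameter. -/
theorem one_sub_norm_le_of_tendsto_norm {s : ℂ → ℂ} {R r : ℝ} {x y : ℝ}
    (hr : 0 < r) (hs : DifferentiableOn ℂ s (halfDisk R)) (hxR : |x| + r < R)
    (hlow : ∀ z ∈ halfDisk R, 1 / 2 ≤ ‖s z‖)
    (hlim : ∀ t : ℝ, |t| < R → Tendsto (fun z => ‖s z‖) (𝓝[halfDisk R] (t : ℂ)) (𝓝 1))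
    (hy : 0 < y) (hyr : y < r) :
    1 - ‖s (x + y * I)‖ ≤ 2 * Real.log 2 / r * y := by
  set M := Real.log 2 with hM
  have hM0 : 0 < M := Real.log_pos one_lt_two
  set P : ℂ → ℂ := fun z => ((M / r ^ 2 : ℝ) : ℂ) * ((z - x) ^ 2 - 2 * I * r * (z - x)) with hP
  have hPre : ∀ z : ℂ, (P z).re = M / r ^ 2 * ((z.re - x) ^ 2 - z.im ^ 2 + 2 * r * z.im) := by
    intro z
    rw [hP]
    dsimp only
    rw [Complex.re_ofReal_mul]
    congr 1
    simp [sq]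
  have hmemR : ∀ z : ℂ, z ∈ closedBall (x : ℂ) r → 0 < z.im → z ∈ halfDisk R := by
    intro z hz hzi
    refine ⟨?_, hzi⟩
    rw [mem_ball_zero_iff]
    rw [mem_closedBall, dist_eq_norm] at hz
    calc ‖z‖ = ‖(x : ℂ) + (z - x)‖ := by ring_nf
      _ ≤ ‖(x : ℂ)‖ + ‖z - x‖ := norm_add_le _ _
      _ < R := by rw [Complex.norm_real, Real.norm_eq_abs]; linarith
  have key : ∀ ε : ℝ, 0 < ε → ε < 1 →
      (1 - ε) * Real.exp (-(P (x + y * I)).re) ≤ ‖s (x + y * I)‖ := by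
    intro ε hε hε1
    obtain ⟨δ, hδ, hδy, hδs⟩ : ∃ δ > 0, δ < y ∧ ∀ z : ℂ, z ∈ closedBall (x : ℂ) r →
        z.im = δ → 1 - ε ≤ ‖s z‖ := by
      have hK : IsCompact ((fun t : ℝ => (t : ℂ)) '' Icc (x - r) (x + r)) :=
        isCompact_Icc.image Complex.continuous_ofReal
      have hN : {z | z ∈ halfDisk R → 1 - ε < ‖s z‖} ∈
          𝓝ˢ ((fun t : ℝ => (t : ℂ)) '' Icc (x - r) (x + r)) := by
        refine mem_nhdsSet_iff_forall.2 ?_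
        rintro _ ⟨t, ht, rfl⟩
        have htR : |t| < R := by
          refine lt_of_le_of_lt ?_ hxR
          have h1 : |t - x| ≤ r := abs_le.2 ⟨by linarith [ht.1], by linarith [ht.2]⟩
          calc |t| = |x + (t - x)| := by ring_nf
            _ ≤ |x| + |t - x| := abs_add_le _ _
            _ ≤ |x| + r := by linarith
        exact mem_nhdsWithin_iff_eventually.1
          ((hlim t htR).eventually_const_lt (by linarith : 1 - ε < 1))
      obtain ⟨d, hd, hdsub⟩ := (hasBasis_nhdsSet_thickening hK).mem_iff.1 hN
      refine ⟨min (d / 2) (y / 2), by positivity, (min_le_right _ _).trans_lt (by linarith),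
        fun z hz hzi => ?_⟩
      have hzpos : 0 < z.im := by rw [hzi]; positivity
      refine (hdsub (mem_thickening_iff.2 ⟨(z.re : ℂ), ⟨z.re, ?_, rfl⟩, ?_⟩)
        (hmemR z hz hzpos)).le
      · rw [mem_closedBall, dist_eq_norm] at hz
        have h1 := (Complex.abs_re_le_norm (z - x)).trans hz
        simp only [sub_re, ofReal_re] at h1
        obtain ⟨h2, h3⟩ := abs_le.1 h1
        exact ⟨by linarith, by linarith⟩
      · have : z - (z.re : ℂ) = z.im * I := by
          apply Complex.ext <;> simp
        rw [dist_eq_norm, this, norm_mul, Complex.norm_I, mul_one, Complex.norm_real,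
          Real.norm_of_nonneg hzpos.le, hzi]
        exact (min_le_left _ _).trans_lt (by linarith)
    set U : Set ℂ := {z | z ∈ ball (x : ℂ) r ∧ δ < z.im} with hU
    have hUo : IsOpen U := isOpen_ball.inter (isOpen_lt continuous_const Complex.continuous_im)
    have hclU : closure U ⊆ {z | z ∈ closedBall (x : ℂ) r ∧ δ ≤ z.im} :=
      closure_minimal (fun z hz => ⟨ball_subset_closedBall hz.1, hz.2.le⟩)
        (isClosed_closedBall.inter (isClosed_le continuous_const Complex.continuous_im))
    have hclU' : closure U ⊆ halfDisk R := fun z hz =>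
      hmemR z (hclU hz).1 (hδ.trans_le (hclU hz).2)
    set g : ℂ → ℂ := fun z => Complex.exp (-P z) / s z with hg
    have hgd : DifferentiableOn ℂ g (halfDisk R) := by
      have hPd : Differentiable ℂ P := by rw [hP]; fun_prop
      refine (hPd.neg.cexp.differentiableOn).fun_div hs fun z hz h0 => ?_
      have := hlow z hz
      rw [h0, norm_zero] at this
      norm_num at this
    have hgn : ∀ z, ‖g z‖ = Real.exp (-(P z).re) / ‖s z‖ := fun z => by
      rw [hg]
      simp [Complex.norm_exp]
    have hbound : ‖g (x + y * I)‖ ≤ 1 / (1 - ε) := by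
      refine Complex.norm_le_of_forall_mem_frontier_norm_le (U := U)
        (isBounded_ball.subset fun z hz => hz.1) (hgd.mono hclU').diffContOnCl ?_ ?_
      · intro z hz
        have hzc := hclU hz.1
        have hzU : z ∉ U := by rw [← hUo.interior_eq]; exact hz.2
        have hzn : (z.re - x) ^ 2 + z.im ^ 2 = ‖z - x‖ ^ 2 := by
          rw [← Complex.normSq_eq_norm_sq, Complex.normSq_apply]
          simp
          ring
        have hzr : ‖z - x‖ ≤ r := by simpa [dist_eq_norm] using hzc.1
        have hzim : z.im ≤ r := by
          have := (Complex.abs_im_le_norm (z - x)).trans hzr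
          simp only [sub_im, ofReal_im, sub_zero] at this
          exact (le_abs_self _).trans this
        rw [hgn, hPre]
        rcases hzc.2.eq_or_lt with h | h
        · have h1 := hδs z hzc.1 h.symm
          have hnn : 0 ≤ M / r ^ 2 * ((z.re - x) ^ 2 - z.im ^ 2 + 2 * r * z.im) := by
            have : 0 ≤ (z.re - x) ^ 2 - z.im ^ 2 + 2 * r * z.im := by
              nlinarith [sq_nonneg (z.re - x)]
            positivity
          exact div_le_div₀ zero_le_one (Real.exp_le_one_iff.2 (by linarith)) (by linarith) h1
        · have hr' : ‖z - x‖ = r := by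
            refine hzr.eq_of_not_lt fun hlt => hzU ⟨?_, h⟩
            rwa [mem_ball, dist_eq_norm]
          have hge : M ≤ M / r ^ 2 * ((z.re - x) ^ 2 - z.im ^ 2 + 2 * r * z.im) := by
            rw [hr'] at hzn
            have h2 : r ^ 2 ≤ (z.re - x) ^ 2 - z.im ^ 2 + 2 * r * z.im := by
              nlinarith
            calc M = M / r ^ 2 * r ^ 2 := by field_simp
              _ ≤ _ := by gcongr
          have h3 :
              Real.exp (-(M / r ^ 2 * ((z.re - x) ^ 2 - z.im ^ 2 + 2 * r * z.im))) ≤ 1 / 2 := by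
            calc _ ≤ Real.exp (-M) := Real.exp_le_exp.2 (by linarith)
              _ = 1 / 2 := by rw [Real.exp_neg, hM, Real.exp_log two_pos, one_div]
          have h4 := hlow z (hclU' hz.1)
          calc _ ≤ (1 / 2) / (1 / 2 : ℝ) := div_le_div₀ (by norm_num) h3 (by norm_num) h4
            _ = 1 := by norm_num
            _ ≤ 1 / (1 - ε) := by rw [le_div_iff₀ (by linarith)]; linarith
      · refine subset_closure ⟨?_, by simpa using hδy⟩
        rw [mem_ball, dist_eq_norm, add_sub_cancel_left, norm_mul, Complex.norm_I, mul_one,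
          Complex.norm_real, Real.norm_of_nonneg hy.le]
        exact hyr
    have hzmem : (x + y * I : ℂ) ∈ halfDisk R := by
      refine hmemR _ ?_ (by simpa using hy)
      rw [mem_closedBall, dist_eq_norm, add_sub_cancel_left, norm_mul, Complex.norm_I, mul_one,
          Complex.norm_real, Real.norm_of_nonneg hy.le]
      exact hyr.le
    have hspos : 0 < ‖s (x + y * I)‖ := by linarith [hlow _ hzmem]
    rw [hgn, div_le_div_iff₀ hspos (by linarith)] at hbound
    linarith
  have hE : Real.exp (-(P (x + y * I)).re) ≤ ‖s (x + y * I)‖ := by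
    have hcont : Tendsto (fun ε : ℝ => (1 - ε) * Real.exp (-(P (x + y * I)).re)) (𝓝[>] 0)
        (𝓝 ((1 - 0) * Real.exp (-(P (x + y * I)).re))) :=
      (Continuous.tendsto (by fun_prop) 0).mono_left nhdsWithin_le_nhds
    rw [sub_zero, one_mul] at hcont
    refine le_of_tendsto hcont ?_
    filter_upwards [Ioo_mem_nhdsGT one_pos] with ε hε using key ε hε.1 hε.2
  have hPle : (P (x + y * I)).re ≤ 2 * M / r * y := by
    rw [hPre]
    simp only [add_re, ofReal_re, mul_re, I_re, mul_zero, ofReal_im, I_im, mul_one, sub_self,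
      add_zero, add_im, mul_im, zero_add]
    have : M / r ^ 2 * (0 ^ 2 - y ^ 2 + 2 * r * y) = 2 * M / r * y - M / r ^ 2 * y ^ 2 := by
      field_simp
      ring
    rw [this]
    have : 0 ≤ M / r ^ 2 * y ^ 2 := by positivity
    linarith
  linarith [Real.add_one_le_exp (-(P (x + y * I)).re)]

/-- A holomorphic map of a half disk into the unit disk, whose modulus tends to `1` at the
diameter, extends continuously near the center. -/
theorem exists_continuous_eqOn_halfDisk {s : ℂ → ℂ} {R : ℝ} (hR : 0 < R)
    (hs : DifferentiableOn ℂ s (halfDisk R)) (hm : MapsTo s (halfDisk R) (ball 0 1))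
    (hlim : ∀ t : ℝ, |t| < R → Tendsto (fun z => ‖s z‖) (𝓝[halfDisk R] (t : ℂ)) (𝓝 1)) :
    ∃ R' > 0, R' ≤ R ∧ ∃ g : ℂ → ℂ, Continuous g ∧ EqOn s g (halfDisk R') := by
  obtain ⟨ρ, hρ, hρR, hlow⟩ : ∃ ρ > 0, ρ ≤ R ∧ ∀ z ∈ halfDisk ρ, 1 / 2 ≤ ‖s z‖ := by
    have h0 := hlim 0 (by simpa using hR)
    have h1 := mem_nhdsWithin_iff_eventually.1
      (h0.eventually_const_lt (by norm_num : (1 / 2 : ℝ) < 1))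
    obtain ⟨d, hd, hdsub⟩ := Metric.eventually_nhds_iff_ball.1 h1
    refine ⟨min d R, lt_min hd hR, min_le_right _ _, fun z hz => ?_⟩
    refine (hdsub z ?_ ⟨ball_subset_ball (min_le_right _ _) hz.1, hz.2⟩).le
    simpa using ball_subset_ball (min_le_left _ _) hz.1
  have hsub : ∀ {r : ℝ}, r ≤ R → halfDisk r ⊆ halfDisk R := fun h z hz =>
    ⟨ball_subset_ball h hz.1, hz.2⟩
  have hsρ := hs.mono (hsub hρR)
  have hlimρ : ∀ t : ℝ, |t| < ρ → Tendsto (fun z => ‖s z‖) (𝓝[halfDisk ρ] (t : ℂ)) (𝓝 1) :=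
    fun t ht => (hlim t (ht.trans_le hρR)).mono_left (nhdsWithin_mono _ (hsub hρR))
  set r := ρ / 4 with hr
  have hr0 : 0 < r := by positivity
  have hderiv : ∀ z ∈ halfDisk r, ‖deriv s z‖₊ ≤ (4 * Real.log 2 / r).toNNReal := by
    intro z hz
    have hzn : ‖z‖ < r := mem_ball_zero_iff.1 hz.1
    have hzre : |z.re| < r := (Complex.abs_re_le_norm z).trans_lt hzn
    have hzim : z.im < r := (le_abs_self _).trans_lt ((Complex.abs_im_le_norm z).trans_lt hzn)
    have hball : ball z z.im ⊆ halfDisk ρ := by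
      intro w hw
      rw [mem_ball, dist_eq_norm] at hw
      refine ⟨?_, ?_⟩
      · rw [mem_ball_zero_iff]
        have : ‖w‖ ≤ ‖w - z‖ + ‖z‖ := by simpa using norm_add_le (w - z) z
        linarith
      · have := (Complex.abs_im_le_norm (w - z)).trans_lt hw
        rw [sub_im] at this
        linarith [(abs_lt.1 this).1]
    have h1 := norm_deriv_le_one_sub_sq_div hz.2 (hsρ.mono hball)
      ((hm.mono_left (hsub hρR)).mono_left hball)
    have h2 := one_sub_norm_le_of_tendsto_norm hr0 hsρ (x := z.re) (y := z.im)
      (by linarith) hlow hlimρ hz.2 hzim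
    rw [Complex.re_add_im] at h2
    have h3 : ‖s z‖ < 1 := mem_ball_zero_iff.1 (hm (hsub hρR (hball (mem_ball_self hz.2))))
    rw [← NNReal.coe_le_coe, coe_nnnorm, Real.coe_toNNReal']
    refine le_max_of_le_left (h1.trans ?_)
    rw [div_le_iff₀ hz.2]
    calc 1 - ‖s z‖ ^ 2 ≤ 2 * (1 - ‖s z‖) := by nlinarith [norm_nonneg (s z)]
      _ ≤ 2 * (2 * Real.log 2 / r * z.im) := by linarith
      _ = 4 * Real.log 2 / r * z.im := by ring
  have hrR : r ≤ R := by linarith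
  have hlip : LipschitzOnWith (4 * Real.log 2 / r).toNNReal s (halfDisk r) :=
    (convex_halfDisk r).lipschitzOnWith_of_nnnorm_deriv_le
      (fun z hz => hs.differentiableAt ((isOpen_halfDisk R).mem_nhds (hsub hrR hz))) hderiv
  obtain ⟨g, hg, hgs⟩ := hlip.extend_finite_dimension
  exact ⟨r, hr0, hrR, g, hg.continuous, hgs⟩

/-- The open annulus `1 - δ < ‖z‖ < 1 + δ`. -/
def unitAnnulus (δ : ℝ) : Set ℂ := {z | |‖z‖ - 1| < δ}

theorem mem_unitAnnulus {δ : ℝ} {z : ℂ} :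
    z ∈ unitAnnulus δ ↔ 1 - δ < ‖z‖ ∧ ‖z‖ < 1 + δ := by
  rw [unitAnnulus, mem_ofPred_eq, abs_lt]
  constructor <;> rintro ⟨h1, h2⟩ <;> constructor <;> linarith

theorem isOpen_unitAnnulus (δ : ℝ) : IsOpen (unitAnnulus δ) :=
  isOpen_lt (by fun_prop) continuous_const

theorem unitAnnulus_mem_nhdsSet {N : Set ℂ} (hN : N ∈ 𝓝ˢ (sphere (0 : ℂ) 1)) :
    ∃ δ > 0, δ < 1 ∧ unitAnnulus δ ⊆ N := by
  obtain ⟨d, hd, hsub⟩ := (hasBasis_nhdsSet_thickening (isCompact_sphere (0 : ℂ) 1)).mem_iff.1 hN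
  refine ⟨min d (1 / 2), by positivity, (min_le_right _ _).trans_lt (by norm_num),
    fun z hz => hsub ?_⟩
  have hz' : |‖z‖ - 1| < min d (1 / 2) := hz
  have hz0 : 0 < ‖z‖ := by
    have := (abs_lt.1 (hz'.trans_le (min_le_right _ _))).1
    linarith
  refine mem_thickening_iff.2 ⟨((‖z‖⁻¹ : ℝ) : ℂ) * z, ?_, ?_⟩
  · rw [mem_sphere_zero_iff_norm, norm_mul, Complex.norm_real, norm_inv, norm_norm,
      inv_mul_cancel₀ hz0.ne']
  · have h1 : z - ((‖z‖⁻¹ : ℝ) : ℂ) * z = ((1 - ‖z‖⁻¹ : ℝ) : ℂ) * z := by push_cast; ring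
    rw [dist_eq_norm, h1, norm_mul, Complex.norm_real, Real.norm_eq_abs]
    calc |1 - ‖z‖⁻¹| * ‖z‖ = |(1 - ‖z‖⁻¹) * ‖z‖| := by rw [abs_mul, abs_of_pos hz0]
      _ = |‖z‖ - 1| := by rw [sub_mul, inv_mul_cancel₀ hz0.ne', one_mul]
      _ < d := hz'.trans_le (min_le_left _ _)

/-- An injective analytic immersion of the unit circle remains one on an annulus. -/
theorem exists_unitAnnulus_injOn {γ : ℂ → ℂ} (han : AnalyticOnNhd ℂ γ (sphere 0 1))
    (hinj : InjOn γ (sphere 0 1)) (hd : ∀ z ∈ sphere (0 : ℂ) 1, deriv γ z ≠ 0) :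
    ∃ δ > 0, δ < 1 ∧ AnalyticOnNhd ℂ γ (unitAnnulus δ) ∧ InjOn γ (unitAnnulus δ) ∧
      ∀ z ∈ unitAnnulus δ, deriv γ z ≠ 0 := by
  obtain ⟨t, ht, hti⟩ := hinj.exists_mem_nhdsSet (isCompact_sphere _ _)
    (fun z hz => (han z hz).continuousAt) fun z hz => by
      have hs := (han z hz).hasStrictDerivAt.hasStrictFDerivAt_equiv (hd z hz)
      refine ⟨(hs.toOpenPartialHomeomorph γ).source,
        (hs.toOpenPartialHomeomorph γ).open_source.mem_nhds hs.mem_toOpenPartialHomeomorph_source,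
        ?_⟩
      simpa using (hs.toOpenPartialHomeomorph γ).injOn
  have h1 : {z | AnalyticAt ℂ γ z} ∈ 𝓝ˢ (sphere (0 : ℂ) 1) :=
    mem_nhdsSet_iff_forall.2 fun z hz => (han z hz).eventually_analyticAt
  have h2 : {z | deriv γ z ≠ 0} ∈ 𝓝ˢ (sphere (0 : ℂ) 1) :=
    mem_nhdsSet_iff_forall.2 fun z hz => (han z hz).deriv.continuousAt.eventually_ne (hd z hz)
  obtain ⟨δ, hδ, hδ1, hsub⟩ := unitAnnulus_mem_nhdsSet (inter_mem (inter_mem ht h1) h2)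
  exact ⟨δ, hδ, hδ1, fun z hz => (hsub hz).1.2, hti.mono fun z hz => (hsub hz).1.1,
    fun z hz => (hsub hz).2⟩

/-- `2πi` times the winding number around `w` of the image under `γ` of the circle of radius `ρ`. -/
def curveIndex (γ : ℂ → ℂ) (ρ : ℝ) (w : ℂ) : ℂ := ∮ z in C(0, ρ), deriv γ z / (γ z - w)

theorem circleIntegrable_deriv_div {γ : ℂ → ℂ} {ρ : ℝ} (hρ : 0 ≤ ρ)
    (han : AnalyticOnNhd ℂ γ (sphere 0 ρ)) {w : ℂ} (hw : w ∉ γ '' sphere 0 ρ) :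
    CircleIntegrable (fun z => deriv γ z / (γ z - w)) 0 ρ := by
  refine ContinuousOn.circleIntegrable hρ fun z hz => ContinuousAt.continuousWithinAt ?_
  exact (han z hz).deriv.continuousAt.div ((han z hz).continuousAt.sub continuousAt_const)
    (sub_ne_zero.2 fun h => hw ⟨z, hz, h⟩)

theorem curveIndex_eventuallyEq {γ : ℂ → ℂ} {ρ : ℝ} (hρ : 0 ≤ ρ)
    (han : AnalyticOnNhd ℂ γ (sphere 0 ρ)) {w : ℂ} (hw : w ∉ γ '' sphere 0 ρ) :
    ∀ᶠ w' in 𝓝 w, curveIndex γ ρ w' = curveIndex γ ρ w := by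
  have hc : IsCompact (γ '' sphere 0 ρ) :=
    (isCompact_sphere _ _).image_of_continuousOn han.continuousOn
  obtain ⟨d, hd, hball⟩ := Metric.isOpen_iff.1 hc.isClosed.isOpen_compl w hw
  filter_upwards [ball_mem_nhds w hd] with w' hw'
  have hfar : ∀ z ∈ sphere (0 : ℂ) ρ, d ≤ ‖γ z - w‖ := fun z hz => by
    rw [← dist_eq_norm]
    exact not_lt.1 fun h => hball (mem_ball.2 h) (mem_image_of_mem γ hz)
  rw [← sub_eq_zero, curveIndex, curveIndex, ← circleIntegral.integral_sub
    (circleIntegrable_deriv_div hρ han (hball hw')) (circleIntegrable_deriv_div hρ han hw)]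
  refine circleIntegral.integral_eq_zero_of_hasDerivWithinAt hρ
    (f := fun z => Complex.log ((γ z - w') / (γ z - w))) fun z hz => ?_
  have h0 : γ z - w ≠ 0 := sub_ne_zero.2 fun h => hw ⟨z, hz, h⟩
  have h0' : γ z - w' ≠ 0 := sub_ne_zero.2 fun h => hball hw' ⟨z, hz, h⟩
  have hγ := (han z hz).differentiableAt.hasDerivAt
  have hslit : (γ z - w') / (γ z - w) ∈ slitPlane := by
    have h1 : (γ z - w') / (γ z - w) = 1 + (w - w') / (γ z - w) := by
      field_simp
      ring
    rw [h1]
    refine Complex.mem_slitPlane_of_norm_lt_one ?_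
    rw [norm_div, div_lt_one (norm_pos_iff.2 h0), ← dist_eq_norm, dist_comm]
    exact (mem_ball.1 hw').trans_le (hfar z hz)
  refine ((((hγ.sub_const w').fun_div (hγ.sub_const w) h0).clog hslit).congr_deriv
    ?_).hasDerivWithinAt
  field_simp

theorem curveIndex_eq_of_isPreconnected {γ : ℂ → ℂ} {ρ : ℝ} (hρ : 0 ≤ ρ)
    (han : AnalyticOnNhd ℂ γ (sphere 0 ρ)) {Ω : Set ℂ} (hΩ : IsOpen Ω) (hc : IsPreconnected Ω)
    (hdisj : Disjoint Ω (γ '' sphere 0 ρ)) {w w' : ℂ} (hw : w ∈ Ω) (hw' : w' ∈ Ω) :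
    curveIndex γ ρ w = curveIndex γ ρ w' := by
  have hd : ∀ x ∈ Ω, HasDerivAt (curveIndex γ ρ) 0 x := fun x hx =>
    (hasDerivAt_const x _).congr_of_eventuallyEq
      (curveIndex_eventuallyEq hρ han (disjoint_left.1 hdisj hx))
  exact hΩ.is_const_of_deriv_eq_zero hc
    (fun x hx => (hd x hx).differentiableAt.differentiableWithinAt)
    (fun x hx => (hd x hx).deriv) hw hw'

theorem closedBall_diff_ball_subset_unitAnnulus {δ ρ : ℝ} (hρδ : 1 - δ < ρ) (hρ1 : ρ < 1) :
    closedBall (0 : ℂ) 1 \ ball 0 ρ ⊆ unitAnnulus δ := by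
  intro z hz
  have h1 : ‖z‖ ≤ 1 := mem_closedBall_zero_iff.1 hz.1
  have h2 : ρ ≤ ‖z‖ := not_lt.1 fun h => hz.2 (mem_ball_zero_iff.2 h)
  exact mem_unitAnnulus.2 ⟨by linarith, by linarith⟩

theorem circleIntegral_eq_of_differentiableAt_annulus {f : ℂ → ℂ} {ρ : ℝ} (hρ : 0 < ρ) (hρ1 : ρ < 1)
    (hf : ∀ z ∈ closedBall (0 : ℂ) 1 \ ball 0 ρ, DifferentiableAt ℂ f z) :
    ∮ z in C(0, 1), f z = ∮ z in C(0, ρ), f z :=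
  Complex.circleIntegral_eq_of_differentiable_on_annulus_off_countable hρ hρ1.le
    countable_empty (fun z hz => (hf z hz).continuousAt.continuousWithinAt)
    fun z hz => hf z ⟨ball_subset_closedBall hz.1.1, fun h => hz.1.2 (ball_subset_closedBall h)⟩

theorem curveIndex_of_one_lt {γ : ℂ → ℂ} {δ ρ : ℝ} (hρ : 0 < ρ) (hρδ : 1 - δ < ρ) (hρ1 : ρ < 1)
    (han : AnalyticOnNhd ℂ γ (unitAnnulus δ)) (hinj : InjOn γ (unitAnnulus δ)) {u : ℂ}
    (hu : u ∈ unitAnnulus δ) (hu1 : 1 < ‖u‖) :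
    curveIndex γ 1 (γ u) = curveIndex γ ρ (γ u) := by
  refine circleIntegral_eq_of_differentiableAt_annulus hρ hρ1 fun z hz => ?_
  have hzA := closedBall_diff_ball_subset_unitAnnulus hρδ hρ1 hz
  refine (han z hzA).deriv.differentiableAt.fun_div ((han z hzA).differentiableAt.sub_const _)
    (sub_ne_zero.2 fun h => ?_)
  rw [hinj hzA hu h] at hz
  exact (mem_closedBall_zero_iff.1 hz.1).not_gt hu1

theorem curveIndex_of_lt_one {γ : ℂ → ℂ} {δ ρ : ℝ} (hρ : 0 < ρ) (hρδ : 1 - δ < ρ) (hρ1 : ρ < 1)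
    (han : AnalyticOnNhd ℂ γ (unitAnnulus δ)) (hinj : InjOn γ (unitAnnulus δ))
    (hd : ∀ z ∈ unitAnnulus δ, deriv γ z ≠ 0) {u : ℂ} (hu : ρ < ‖u‖) (hu1 : ‖u‖ < 1) :
    curveIndex γ 1 (γ u) = 2 * Real.pi * I + curveIndex γ ρ (γ u) := by
  have hsub := closedBall_diff_ball_subset_unitAnnulus hρδ hρ1
  have huA : u ∈ unitAnnulus δ :=
    hsub ⟨mem_closedBall_zero_iff.2 hu1.le, fun h => hu.not_gt (mem_ball_zero_iff.1 h)⟩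
  set q := dslope γ u with hq
  have hqd : DifferentiableOn ℂ q (unitAnnulus δ) :=
    (Complex.differentiableOn_dslope ((isOpen_unitAnnulus δ).mem_nhds huA)).2 han.differentiableOn
  have hqa : AnalyticOnNhd ℂ q (unitAnnulus δ) := hqd.analyticOnNhd (isOpen_unitAnnulus δ)
  have hγq : ∀ z, γ z = γ u + (z - u) * q z := fun z => by
    have := sub_smul_dslope γ u z
    rw [smul_eq_mul, ← hq] at this
    rw [this]
    ring
  have hq0 : ∀ z ∈ unitAnnulus δ, q z ≠ 0 := by
    intro z hz h0
    rcases eq_or_ne z u with rfl | hzu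
    · rw [hq, dslope_same] at h0
      exact hd z hz h0
    · refine hzu (hinj hz huA ?_)
      rw [hγq z, h0, mul_zero, add_zero]
  have hint : ∀ z ∈ unitAnnulus δ, z ≠ u →
      deriv γ z / (γ z - γ u) = (z - u)⁻¹ + deriv q z / q z := by
    intro z hz hzu
    have h1 : HasDerivAt γ (1 * q z + (z - u) * deriv q z) z := by
      have h2 := (((hasDerivAt_id z).sub_const u).fun_mul
        (hqa z hz).differentiableAt.hasDerivAt).const_add (γ u)
      exact h2.congr_of_eventuallyEq (Eventually.of_forall hγq)
    have h3 := hq0 z hz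
    have h4 := sub_ne_zero.2 hzu
    rw [h1.deriv, hγq z, add_sub_cancel_left]
    field_simp
  have hqq : ∮ z in C(0, 1), deriv q z / q z = ∮ z in C(0, ρ), deriv q z / q z :=
    circleIntegral_eq_of_differentiableAt_annulus hρ hρ1 fun z hz =>
      (hqa z (hsub hz)).deriv.differentiableAt.fun_div (hqa z (hsub hz)).differentiableAt
        (hq0 z (hsub hz))
  have hcalc : ∀ r : ℝ, 0 ≤ r → sphere (0 : ℂ) r ⊆ closedBall (0 : ℂ) 1 \ ball 0 ρ → r ≠ ‖u‖ →
      curveIndex γ r (γ u) =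
        (∮ z in C(0, r), (z - u)⁻¹) + ∮ z in C(0, r), deriv q z / q z := by
    intro r hr hrs hru
    have hne : ∀ z ∈ sphere (0 : ℂ) r, z ≠ u := fun z hz h =>
      hru (by rw [← h, mem_sphere_zero_iff_norm.1 hz])
    rw [← circleIntegral.integral_add]
    · exact circleIntegral.integral_congr hr fun z hz => hint z (hsub (hrs hz)) (hne z hz)
    · exact ContinuousOn.circleIntegrable hr fun z hz => ((continuousAt_id.sub
        continuousAt_const).inv₀ (sub_ne_zero.2 (hne z hz))).continuousWithinAt
    · exact ContinuousOn.circleIntegrable hr fun z hz =>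
        ((hqa z (hsub (hrs hz))).deriv.continuousAt.div (hqa z (hsub (hrs hz))).continuousAt
          (hq0 z (hsub (hrs hz)))).continuousWithinAt
  have hρ0 : ∮ z in C(0, ρ), (z - u)⁻¹ = 0 := by
    have hda : ∀ z ∈ closedBall (0 : ℂ) ρ, DifferentiableAt ℂ (fun z => (z - u)⁻¹) z := by
      intro z hz
      refine (differentiableAt_id.sub_const u).fun_inv (sub_ne_zero.2 ?_)
      rintro rfl
      exact (mem_closedBall_zero_iff.1 hz).not_gt hu
    exact Complex.circleIntegral_eq_zero_of_differentiable_on_off_countable hρ.le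
      countable_empty (fun z hz => (hda z hz).continuousAt.continuousWithinAt)
      fun z hz => hda z (ball_subset_closedBall hz.1)
  rw [hcalc 1 zero_le_one ?_ hu1.ne', hcalc ρ hρ.le ?_ hu.ne, hqq, hρ0,
    circleIntegral.integral_sub_inv_of_mem_ball (mem_ball_zero_iff.2 hu1), zero_add]
  · intro z hz
    have := mem_sphere_zero_iff_norm.1 hz
    exact ⟨mem_closedBall_zero_iff.2 (by linarith), fun h => (mem_ball_zero_iff.1 h).ne this⟩
  · intro z hz
    have := mem_sphere_zero_iff_norm.1 hz
    exact ⟨mem_closedBall_zero_iff.2 this.le,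
      fun h => by linarith [mem_ball_zero_iff.1 h]⟩

/-- A connected open set disjoint from a simple closed analytic curve cannot lie on both sides of
the curve near a point of it. -/
theorem exists_unitAnnulus_not_mem_both {γ : ℂ → ℂ} {δ : ℝ} (hδ : 0 < δ) (hδ1 : δ < 1)
    (han : AnalyticOnNhd ℂ γ (unitAnnulus δ)) (hinj : InjOn γ (unitAnnulus δ))
    (hd : ∀ z ∈ unitAnnulus δ, deriv γ z ≠ 0) {Ω : Set ℂ} (hΩ : IsOpen Ω)
    (hc : IsPreconnected Ω) (hdisj : Disjoint Ω (γ '' sphere 0 1)) {v : ℂ} (hv : ‖v‖ = 1) :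
    ∃ N ∈ 𝓝 v, ∀ u ∈ N, ∀ u' ∈ N, 1 < ‖u‖ → ‖u'‖ < 1 → γ u ∈ Ω → γ u' ∉ Ω := by
  set ρ := 1 - δ / 2 with hρ
  have hρ0 : 0 < ρ := by linarith
  have hρδ : 1 - δ < ρ := by linarith
  have hρ1 : ρ < 1 := by linarith
  have hvA : v ∈ unitAnnulus δ := by simpa [unitAnnulus, hv] using hδ
  have hsub : sphere (0 : ℂ) ρ ⊆ unitAnnulus δ := fun z hz => by
    have := mem_sphere_zero_iff_norm.1 hz
    exact mem_unitAnnulus.2 ⟨by linarith, by linarith⟩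
  have hsub1 : sphere (0 : ℂ) 1 ⊆ unitAnnulus δ := fun z hz => by
    simpa [unitAnnulus, mem_sphere_zero_iff_norm.1 hz] using hδ
  have hvρ : γ v ∉ γ '' sphere 0 ρ := by
    rintro ⟨z, hz, hzv⟩
    rw [hinj (hsub hz) hvA hzv, mem_sphere_zero_iff_norm] at hz
    linarith
  have hev := (han v hvA).continuousAt.eventually
    (curveIndex_eventuallyEq hρ0.le (han.mono hsub) hvρ)
  have hnorm : ∀ᶠ z : ℂ in 𝓝 v, ρ < ‖z‖ :=
    continuous_norm.continuousAt.eventually_const_lt (by simpa [hv] using hρ1)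
  refine ⟨_, (hev.and (hnorm.and ((isOpen_unitAnnulus δ).mem_nhds hvA))), ?_⟩
  rintro u ⟨hu, -, huA⟩ u' ⟨hu', hρu', -⟩ h1 h1' hγu hγu'
  have e1 := curveIndex_of_one_lt hρ0 hρδ hρ1 han hinj huA h1
  have e2 := curveIndex_of_lt_one hρ0 hρδ hρ1 han hinj hd hρu' h1'
  have e3 := curveIndex_eq_of_isPreconnected zero_le_one (han.mono hsub1) hΩ hc hdisj hγu hγu'
  rw [e1, e2, hu, hu'] at e3
  simp at e3

/-- A preconnected set which meets an open set and avoids its frontier lies in the open set. -/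
theorem IsPreconnected.subset_of_disjoint_frontier {s Ω : Set ℂ} (hs : IsPreconnected s)
    (hΩ : IsOpen Ω) (hne : (s ∩ Ω).Nonempty) (hd : Disjoint s (frontier Ω)) : s ⊆ Ω := by
  refine hs.subset_of_closure_inter_subset hΩ hne fun z hz => ?_
  by_contra h
  refine disjoint_left.1 hd hz.2 ⟨hz.1, ?_⟩
  rwa [hΩ.interior_eq]

theorem norm_exp_I_mul (z : ℂ) : ‖Complex.exp (I * z)‖ = Real.exp (-z.im) := by
  simp [Complex.norm_exp]

/-- Near each boundary point, `Ω` is conformally straightened to the upper half plane. -/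
theorem MCDomain.exists_boundary_chart (D : MCDomain n) {ξ : ℂ} (hξ : ξ ∈ frontier D.Ω) :
    ∃ e : OpenPartialHomeomorph ℂ ℂ, ∃ R > 0, ball 0 R ⊆ e.source ∧ e 0 = ξ ∧
      DifferentiableOn ℂ e (ball 0 R) ∧ ∀ z ∈ ball (0 : ℂ) R, e z ∈ D.Ω ↔ 0 < z.im := by
  have hξ' := hξ
  rw [D.frontier_eq, mem_iUnion] at hξ'
  obtain ⟨j, hj⟩ := hξ'
  obtain ⟨γ, han₁, hinj₁, hγΓ, hd₁⟩ := D.curve j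
  obtain ⟨δ, hδ, hδ1, han, hinj, hd⟩ := exists_unitAnnulus_injOn han₁ hinj₁ hd₁
  have hsph : sphere (0 : ℂ) 1 ⊆ unitAnnulus δ := fun z hz => by
    simpa [unitAnnulus, mem_sphere_zero_iff_norm.1 hz] using hδ
  obtain ⟨v, hv, rfl⟩ : ξ ∈ γ '' sphere 0 1 := by rwa [hγΓ]
  have hv1 : ‖v‖ = 1 := mem_sphere_zero_iff_norm.1 hv
  have hfr : ∀ k, D.Γ k ⊆ frontier D.Ω := fun k => by
    rw [D.frontier_eq]
    exact subset_iUnion _ k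
  have hΩfr : ∀ w ∈ frontier D.Ω, w ∉ D.Ω := fun w hw h => by
    rw [← D.isOpen.interior_eq] at h
    exact hw.2 h
  have hdisj : Disjoint D.Ω (γ '' sphere 0 1) := by
    rw [hγΓ, disjoint_right]
    exact fun w hw => hΩfr w (hfr j hw)
  obtain ⟨N, hN, hNside⟩ := exists_unitAnnulus_not_mem_both hδ hδ1 han hinj hd D.isOpen
    D.conn.isPreconnected hdisj hv1
  have hother : ∀ᶠ w in 𝓝 (γ v), ∀ k, k ≠ j → w ∉ D.Γ k := by
    refine eventually_all.2 fun k => ?_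
    by_cases hkj : k = j
    · exact Eventually.of_forall fun w h => absurd hkj h
    · obtain ⟨γk, hank, -, hΓk, -⟩ := D.curve k
      have hcl : IsClosed (D.Γ k) := by
        rw [← hΓk]
        exact ((isCompact_sphere _ _).image_of_continuousOn hank.continuousOn).isClosed
      have : γ v ∉ D.Γ k := fun h => disjoint_left.1 (D.disj k j hkj) h hj
      filter_upwards [hcl.isOpen_compl.mem_nhds this] with w hw _ using hw
  set p : ℂ → ℂ := fun z => v * Complex.exp (I * z) with hp
  have hpn : ∀ z, ‖p z‖ = Real.exp (-z.im) := fun z => by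
    rw [hp, norm_mul, hv1, one_mul, norm_exp_I_mul]
  have hp0 : p 0 = v := by simp [hp]
  have hpd : Differentiable ℂ p := by rw [hp]; fun_prop
  have hpd0 : deriv p 0 ≠ 0 := by
    have h1 : HasDerivAt p (v * (Complex.exp (I * 0) * (I * 1))) 0 :=
      (((hasDerivAt_id (0 : ℂ)).const_mul I).cexp).const_mul v
    rw [h1.deriv]
    have hv0 : v ≠ 0 := norm_ne_zero_iff.1 (by rw [hv1]; exact one_ne_zero)
    simp [hv0]
  have hpa : AnalyticAt ℂ p 0 := hpd.analyticAt 0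
  have hφa : AnalyticAt ℂ (γ ∘ p) 0 := by
    refine AnalyticAt.comp ?_ hpa
    rw [hp0]
    exact han v (hsph hv)
  have hφd : deriv (γ ∘ p) 0 ≠ 0 := by
    rw [deriv_comp (0 : ℂ) (by rw [hp0]; exact (han v (hsph hv)).differentiableAt)
      hpd.differentiableAt, hp0]
    exact mul_ne_zero (hd v (hsph hv)) hpd0
  have hstrict := hφa.hasStrictDerivAt.hasStrictFDerivAt_equiv hφd
  set e := hstrict.toOpenPartialHomeomorph (γ ∘ p) with he
  have hecoe : ∀ z, e z = γ (p z) := fun z => by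
    rw [he, hstrict.toOpenPartialHomeomorph_coe, Function.comp_apply]
  have hpc : Tendsto p (𝓝 0) (𝓝 v) := by
    simpa [hp0] using hpd.continuous.tendsto 0
  have hφc : Tendsto (fun z => γ (p z)) (𝓝 0) (𝓝 (γ v)) :=
    (han v (hsph hv)).continuousAt.tendsto.comp hpc
  have hev : ∀ᶠ z in 𝓝 (0 : ℂ), z ∈ e.source ∧ p z ∈ N ∧ p z ∈ unitAnnulus δ ∧
      ∀ k, k ≠ j → γ (p z) ∉ D.Γ k := by
    have h1 : e.source ∈ 𝓝 (0 : ℂ) :=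
      e.open_source.mem_nhds hstrict.mem_toOpenPartialHomeomorph_source
    filter_upwards [h1, hpc hN, hpc ((isOpen_unitAnnulus δ).mem_nhds (hsph hv)),
      hφc.eventually hother] with z a b c d using ⟨a, b, c, d⟩
  obtain ⟨R, hR, hball⟩ := Metric.eventually_nhds_iff_ball.1 hev
  have hdiff : DifferentiableOn ℂ e (ball 0 R) := fun z hz => by
    have h1 : DifferentiableAt ℂ (fun z => γ (p z)) z :=
      DifferentiableAt.fun_comp' z (han _ (hball z hz).2.2.1).differentiableAt
        hpd.differentiableAt
    exact (h1.congr_of_eventuallyEq (Eventually.of_forall hecoe)).differentiableWithinAt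
  have hfront : ∀ z ∈ ball (0 : ℂ) R, (e z ∈ frontier D.Ω ↔ z.im = 0) := by
    intro z hz
    obtain ⟨-, -, hzA, hzk⟩ := hball z hz
    rw [hecoe]
    constructor
    · intro h
      rw [D.frontier_eq, mem_iUnion] at h
      obtain ⟨k, hk⟩ := h
      rcases eq_or_ne k j with rfl | hkj
      · rw [← hγΓ] at hk
        obtain ⟨u, hu, huz⟩ := hk
        rw [hinj (hsph hu) hzA huz, mem_sphere_zero_iff_norm, hpn, Real.exp_eq_one_iff] at hu
        linarith
      · exact absurd hk (hzk k hkj)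
    · intro h
      refine hfr j ?_
      rw [← hγΓ]
      exact mem_image_of_mem γ (mem_sphere_zero_iff_norm.2 (by rw [hpn, h]; simp))
  have hhalf : ∀ S : Set ℂ, Convex ℝ S → S ⊆ ball 0 R → (∀ z ∈ S, z.im ≠ 0) →
      (∃ z ∈ S, e z ∈ D.Ω) → ∀ z ∈ S, e z ∈ D.Ω := by
    rintro S hS hSR hS0 ⟨z₀, hz₀, hez₀⟩ z hz
    have hc : IsPreconnected (e '' S) :=
      hS.isPreconnected.image e (hdiff.continuousOn.mono hSR)
    refine hc.subset_of_disjoint_frontier D.isOpen ⟨e z₀, mem_image_of_mem e hz₀, hez₀⟩ ?_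
      (mem_image_of_mem e hz)
    rw [disjoint_left]
    rintro _ ⟨x, hx, rfl⟩ h
    exact hS0 x hx ((hfront x (hSR hx)).1 h)
  set S₁ : Set ℂ := {z | z ∈ ball (0 : ℂ) R ∧ 0 < z.im} with hS₁
  set S₂ : Set ℂ := {z | z ∈ ball (0 : ℂ) R ∧ z.im < 0} with hS₂
  have hup := hhalf S₁ ((convex_ball (0 : ℂ) R).inter (convex_halfSpace_im_gt 0))
    (fun z hz => hz.1) (fun z hz => hz.2.ne')
  have hlo := hhalf S₂ ((convex_ball (0 : ℂ) R).inter (convex_halfSpace_im_lt 0))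
    (fun z hz => hz.1) (fun z hz => hz.2.ne)
  have hboth : ∀ z ∈ S₁, ∀ z' ∈ S₂, e z ∈ D.Ω → e z' ∈ D.Ω → False := by
    intro z hz z' hz' h h'
    rw [hecoe] at h h'
    refine hNside (p z') (hball z' hz'.1).2.1 (p z) (hball z hz.1).2.1 ?_ ?_ h' h
    · rw [hpn, Real.one_lt_exp_iff]
      linarith [hz'.2]
    · rw [hpn, Real.exp_lt_one_iff]
      linarith [hz.2]
  have hzero : ∀ z ∈ ball (0 : ℂ) R, z.im = 0 → e z ∉ D.Ω := fun z hz h =>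
    hΩfr _ ((hfront z hz).2 h)
  have hR0 : (0 : ℂ) ∈ ball (0 : ℂ) R := mem_ball_self hR
  have he0 : e 0 = γ v := by rw [hecoe, hp0]
  obtain ⟨z₀, hz₀, hez₀⟩ : ∃ z ∈ ball (0 : ℂ) R, e z ∈ D.Ω := by
    have h1 := e.image_mem_nhds (hball 0 hR0).1 (ball_mem_nhds (0 : ℂ) hR)
    rw [he0] at h1
    obtain ⟨_, ⟨z, hz, rfl⟩, hw⟩ := mem_closure_iff_nhds.1 hξ.1 _ h1
    exact ⟨z, hz, hw⟩
  rcases lt_trichotomy z₀.im 0 with h | h | h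
  · refine ⟨(Homeomorph.neg ℂ).toOpenPartialHomeomorph.trans e, R, hR, ?_, ?_, ?_, ?_⟩
    · intro z hz
      have hz' : -z ∈ ball (0 : ℂ) R := by simpa using hz
      simpa using (hball _ hz').1
    · simpa using he0
    · have : MapsTo (fun z : ℂ => -z) (ball 0 R) (ball 0 R) := fun z hz => by simpa using hz
      exact hdiff.comp differentiable_neg.differentiableOn this
    · intro z hz
      have hz' : -z ∈ ball (0 : ℂ) R := by simpa using hz
      change e (-z) ∈ D.Ω ↔ 0 < z.im
      have hall := hlo ⟨z₀, ⟨hz₀, h⟩, hez₀⟩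
      constructor
      · intro hez
        by_contra hneg
        rcases (not_lt.1 hneg).lt_or_eq with hlt | heq
        · exact hboth (-z) ⟨hz', by simpa using hlt⟩ z₀ ⟨hz₀, h⟩ hez hez₀
        · exact hzero (-z) hz' (by simpa using heq) hez
      · exact fun hpos => hall (-z) ⟨hz', by simpa using hpos⟩
  · exact absurd hez₀ (hzero z₀ hz₀ h)
  · refine ⟨e, R, hR, fun z hz => (hball z hz).1, he0, hdiff, fun z hz => ⟨fun hez => ?_,
      fun hpos => hup ⟨z₀, ⟨hz₀, h⟩, hez₀⟩ z ⟨hz, hpos⟩⟩⟩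
    by_contra hneg
    rcases (not_lt.1 hneg).lt_or_eq with hlt | heq
    · exact hboth z₀ ⟨hz₀, h⟩ z ⟨hz, hlt⟩ hez₀ hez
    · exact hzero z hz heq hez

namespace IsCoveringOfDisk

/-- The modulus of a lift tends to `1` where the lifted map leaves `Ω`. -/
theorem tendsto_norm_lift {Ω : Set ℂ} {w₀ : ℂ} {τ : ℂ → ℂ} (hτ : IsCoveringOfDisk Ω w₀ τ)
    {A : Set ℂ} {φ s : ℂ → ℂ} {t : ℂ} (hφ : ContinuousAt φ t) (ht : φ t ∉ Ω)
    (hsm : MapsTo s A (ball 0 1)) (h : ∀ x ∈ A, τ (s x) = φ x) :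
    Tendsto (fun z => ‖s z‖) (𝓝[A] t) (𝓝 1) := by
  refine tendsto_order.2 ⟨fun c hc => ?_, fun c hc => ?_⟩
  · have hsub : closedBall (0 : ℂ) c ⊆ ball 0 1 := closedBall_subset_ball hc
    have hK : IsCompact (τ '' closedBall 0 c) :=
      (isCompact_closedBall _ _).image_of_continuousOn (hτ.diff.continuousOn.mono hsub)
    have htK : φ t ∉ τ '' closedBall 0 c := by
      rintro ⟨p, hp, hpt⟩
      exact ht (hpt ▸ hτ.mapsTo p (hsub hp))
    filter_upwards [nhdsWithin_le_nhds (hφ (hK.isClosed.isOpen_compl.mem_nhds htK)),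
      self_mem_nhdsWithin] with z hz hzA
    by_contra hcz
    exact hz ⟨s z, mem_closedBall_zero_iff.2 (not_lt.1 hcz), h z hzA⟩
  · filter_upwards [self_mem_nhdsWithin] with z hzA
    exact (mem_ball_zero_iff.1 (hsm hzA)).trans hc

/-- Near a boundary point `ξ`, a measurable function of the radial limit of `τ` at `ζ` selects a
point of the orbit of `ζ` under the deck group. -/
theorem exists_nhds_measurable_selector {D : MCDomain n} {τ : ℂ → ℂ}
    (hτ : IsCoveringOfDisk D.Ω D.w₀ τ) {S : Set (ℂ → ℂ)} (hS : ∀ σ ∈ S, IsDeck τ σ)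
    (htrans : ∀ z₁ ∈ ball (0 : ℂ) 1, ∀ z₂ ∈ ball (0 : ℂ) 1, τ z₁ = τ z₂ → ∃ σ ∈ S, σ z₁ = z₂)
    {ξ : ℂ} (hξ : ξ ∈ frontier D.Ω) :
    ∃ V : Set ℂ, IsOpen V ∧ ξ ∈ V ∧ ∃ g : ℂ → ℂ, Measurable g ∧ ∀ ζ η : ℂ, ‖ζ‖ = 1 → η ∈ V →
      Tendsto (fun r : ℝ => τ (r * ζ)) (𝓝[<] 1) (𝓝 η) → ∃ σ ∈ S, σ ζ = g η := by
  classical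
  obtain ⟨e, R, hR, hRe, he0, hed, heΩ⟩ := D.exists_boundary_chart hξ
  have hsub : halfDisk R ⊆ ball 0 R := fun z hz => hz.1
  have hem : MapsTo e (halfDisk R) D.Ω := fun z hz => (heΩ z hz.1).2 hz.2
  have hbase : ((R / 2 : ℝ) : ℂ) * I ∈ halfDisk R := by
    refine ⟨?_, by simpa using hR⟩
    rw [mem_ball_zero_iff, norm_mul, Complex.norm_I, mul_one, Complex.norm_real,
      Real.norm_of_nonneg (by positivity)]
    linarith
  obtain ⟨p, hp, hpe⟩ := hτ.surj (hem hbase)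
  obtain ⟨s, hs, hsm, -, hsτ⟩ := hτ.exists_lift (convex_halfDisk R) (isOpen_halfDisk R)
    (hed.continuousOn.mono hsub) hem hbase hp hpe
  have hsd := hτ.differentiableOn_lift (isOpen_halfDisk R) (hed.mono hsub) hs hsm hsτ
  have hlim : ∀ t : ℝ, |t| < R → Tendsto (fun z => ‖s z‖) (𝓝[halfDisk R] (t : ℂ)) (𝓝 1) := by
    intro t ht
    have htR : (t : ℂ) ∈ ball (0 : ℂ) R := by simpa using ht
    refine hτ.tendsto_norm_lift (hed.continuousOn.continuousAt (isOpen_ball.mem_nhds htR))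
      (fun h => ?_) hsm hsτ
    simpa using (heΩ t htR).1 h
  obtain ⟨R', hR', hR'R, g, hg, hsg⟩ := exists_continuous_eqOn_halfDisk hR hsd hsm hlim
  have hRe' : ball 0 R' ⊆ e.source := (ball_subset_ball hR'R).trans hRe
  have hV : IsOpen (e '' ball 0 R') := e.isOpen_image_of_subset_source isOpen_ball hRe'
  have hVt : e '' ball 0 R' ⊆ e.target := by
    rintro _ ⟨z, hz, rfl⟩
    exact e.map_source (hRe' hz)
  refine ⟨e '' ball 0 R', hV, ⟨0, mem_ball_self hR', he0⟩,
    (e '' ball 0 R').piecewise (g ∘ e.symm) 0,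
    (hg.comp_continuousOn (e.continuousOn_symm.mono hVt)).measurable_piecewise
      continuousOn_const hV.measurableSet, fun ζ η hζ hη hτη => ?_⟩
  rw [piecewise_eq_of_mem _ _ _ hη]
  have hnorm : ∀ r : ℝ, ‖(r : ℂ) * ζ‖ = |r| := fun r => by
    rw [norm_mul, hζ, mul_one, Complex.norm_real, Real.norm_eq_abs]
  have hball : ∀ r : ℝ, 0 ≤ r → r < 1 → (r : ℂ) * ζ ∈ ball (0 : ℂ) 1 := fun r h0 h1 => by
    rwa [mem_ball_zero_iff, hnorm, abs_of_nonneg h0]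
  obtain ⟨r₀, hr₀, hr₀V⟩ : ∃ r₀ ∈ Ico (0 : ℝ) 1, ∀ r ∈ Ico r₀ 1,
      τ (r * ζ) ∈ e '' ball 0 R' := by
    obtain ⟨a, ha, hsubs⟩ := mem_nhdsLT_iff_exists_Ioo_subset.1 (hτη (hV.mem_nhds hη))
    have ha : a < 1 := ha
    refine ⟨max 0 ((a + 1) / 2), ⟨le_max_left _ _, max_lt one_pos (by linarith)⟩,
      fun r hr => hsubs ⟨?_, hr.2⟩⟩
    linarith [(le_max_right 0 ((a + 1) / 2)).trans hr.1]
  have hIco : ∀ r ∈ Ico r₀ 1, (r : ℂ) * ζ ∈ ball (0 : ℂ) 1 := fun r hr =>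
    hball r (hr₀.1.trans hr.1) hr.2
  have hsymm : ∀ r ∈ Ico r₀ 1, e.symm (τ (r * ζ)) ∈ halfDisk R' ∧
      e (e.symm (τ (r * ζ))) = τ (r * ζ) := by
    intro r hr
    obtain ⟨z, hz, hze⟩ := hr₀V r hr
    have hΩ := hτ.mapsTo _ (hIco r hr)
    rw [← hze] at hΩ ⊢
    rw [e.left_inv (hRe' hz)]
    exact ⟨⟨hz, (heΩ z (ball_subset_ball hR'R hz)).1 hΩ⟩, rfl⟩
  have hhd : ∀ r ∈ Ico r₀ 1, e.symm (τ (r * ζ)) ∈ halfDisk R := fun r hr =>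
    ⟨ball_subset_ball hR'R (hsymm r hr).1.1, (hsymm r hr).1.2⟩
  have hr₀mem : r₀ ∈ Ico r₀ 1 := ⟨le_rfl, hr₀.2⟩
  obtain ⟨σ, hσS, hσr₀⟩ := htrans _ (hIco r₀ hr₀mem) _ (hsm (hhd r₀ hr₀mem))
    (by rw [hsτ _ (hhd r₀ hr₀mem), (hsymm r₀ hr₀mem).2])
  refine ⟨σ, hσS, ?_⟩
  have hσ := hS σ hσS
  have hmul : Continuous fun r : ℝ => (r : ℂ) * ζ := by fun_prop
  have hτc : ContinuousOn (fun r : ℝ => τ (r * ζ)) (Ico r₀ 1) :=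
    hτ.diff.continuousOn.comp hmul.continuousOn hIco
  have heq : EqOn (fun r : ℝ => σ (r * ζ)) (fun r : ℝ => s (e.symm (τ (r * ζ)))) (Ico r₀ 1) := by
    refine hτ.eqOn_of_lift isPreconnected_Ico ?_ ?_ ?_ ?_ ?_ hr₀mem hσr₀
    · intro r hr
      have h1 := (hσ.1.differentiableAt (mem_ball_zero_iff.1 (hIco r hr)).le).continuousAt
      exact (ContinuousAt.comp (f := fun r : ℝ => (r : ℂ) * ζ) h1
        hmul.continuousAt).continuousWithinAt
    · exact hs.comp (e.continuousOn_symm.comp hτc fun r hr => hVt (hr₀V r hr)) hhd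
    · exact fun r hr => hσ.1.mapsTo_ball (hIco r hr)
    · exact fun r hr => hsm (hhd r hr)
    · intro r hr
      rw [hσ.2 _ (hIco r hr), hsτ _ (hhd r hr), (hsymm r hr).2]
  have hl : Tendsto (fun r : ℝ => σ (r * ζ)) (𝓝[<] 1) (𝓝 (σ ζ)) := by
    have h1 := (hσ.1.differentiableAt hζ.le).continuousAt.tendsto
    have h2 : Tendsto (fun r : ℝ => (r : ℂ) * ζ) (𝓝[<] 1) (𝓝 ζ) := by
      simpa using (hmul.tendsto 1).mono_left nhdsWithin_le_nhds
    exact h1.comp h2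
  have hr : Tendsto (fun r : ℝ => g (e.symm (τ (r * ζ)))) (𝓝[<] 1) (𝓝 (g (e.symm η))) :=
    (hg.continuousAt.tendsto.comp (e.continuousAt_symm (hVt hη)).tendsto).comp hτη
  refine tendsto_nhds_unique (hl.congr' ?_) hr
  filter_upwards [Ico_mem_nhdsLT hr₀.2] with r hr
  exact (heq hr).trans (hsg (hsymm r hr).1)

/-- A measurable function of the radial limit of `τ` at `ζ` selects a point of the orbit of `ζ`
under the deck group. -/
theorem exists_measurable_selector {D : MCDomain n} {τ : ℂ → ℂ}
    (hτ : IsCoveringOfDisk D.Ω D.w₀ τ) {S : Set (ℂ → ℂ)} (hS : ∀ σ ∈ S, IsDeck τ σ)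
    (htrans : ∀ z₁ ∈ ball (0 : ℂ) 1, ∀ z₂ ∈ ball (0 : ℂ) 1, τ z₁ = τ z₂ → ∃ σ ∈ S, σ z₁ = z₂) :
    ∃ g : ℂ → ℂ, Measurable g ∧ ∀ ζ η : ℂ, ‖ζ‖ = 1 → η ∈ frontier D.Ω →
      Tendsto (fun r : ℝ => τ (r * ζ)) (𝓝[<] 1) (𝓝 η) → ∃ σ ∈ S, σ ζ = g η := by
  classical
  have hcomp : IsCompact (frontier D.Ω) :=
    D.bdd.isCompact_closure.of_isClosed_subset isClosed_frontier frontier_subset_closure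
  let P : Set ℂ → Prop := fun T => ∃ V, MeasurableSet V ∧ T ⊆ V ∧ ∃ g : ℂ → ℂ, Measurable g ∧
    ∀ ζ η : ℂ, ‖ζ‖ = 1 → η ∈ V →
      Tendsto (fun r : ℝ => τ (r * ζ)) (𝓝[<] 1) (𝓝 η) → ∃ σ ∈ S, σ ζ = g η
  obtain ⟨V, -, hTV, g, hg, hgV⟩ : P (frontier D.Ω) := by
    refine hcomp.induction_on (p := P) ?_ ?_ ?_ ?_
    · exact ⟨∅, .empty, Subset.rfl, 0, measurable_const, fun _ _ _ h => absurd h (notMem_empty _)⟩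
    · rintro T T' hT ⟨V, hV, hTV, h⟩
      exact ⟨V, hV, hT.trans hTV, h⟩
    · rintro T T' ⟨V, hV, hTV, g, hg, h⟩ ⟨V', hV', hTV', g', hg', h'⟩
      refine ⟨V ∪ V', hV.union hV', union_subset_union hTV hTV', V.piecewise g g',
        hg.piecewise hV hg', fun ζ η hζ hη hlim => ?_⟩
      by_cases hηV : η ∈ V
      · rw [piecewise_eq_of_mem _ _ _ hηV]
        exact h ζ η hζ hηV hlim
      · rw [piecewise_eq_of_notMem _ _ _ hηV]
        exact h' ζ η hζ (hη.resolve_left hηV) hlim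
    · intro ξ hξ
      obtain ⟨V, hV, hξV, h⟩ := hτ.exists_nhds_measurable_selector hS htrans hξ
      exact ⟨V, mem_nhdsWithin_of_mem_nhds (hV.mem_nhds hξV), V, hV.measurableSet, Subset.rfl, h⟩
  exact ⟨g, hg, fun ζ η hζ hη => hgV ζ η hζ (hTV hη)⟩

end IsCoveringOfDisk

theorem circleMeasure_eq_zero_iff {E : Set ℂ} (hE : MeasurableSet E) :
    circleMeasure E = 0 ↔
      volume {t : ℝ | Complex.exp (t * I) ∈ E ∧ t ∈ Ioc 0 (2 * Real.pi)} = 0 := by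
  have hm : Measurable fun t : ℝ => Complex.exp (t * I) := by fun_prop
  rw [circleMeasure, Measure.smul_apply, smul_eq_mul, mul_eq_zero, Measure.map_apply hm hE,
    Measure.restrict_apply (hm hE)]
  refine ⟨fun h => h.resolve_left (ENNReal.inv_ne_zero.2 ENNReal.ofReal_ne_top), Or.inr⟩

theorem ae_norm_eq_one : ∀ᵐ ζ ∂circleMeasure, ‖ζ‖ = 1 := by
  have hm : MeasurableSet {ζ : ℂ | ¬‖ζ‖ = 1} :=
    (isClosed_eq continuous_norm continuous_const).measurableSet.compl
  rw [ae_iff, circleMeasure_eq_zero_iff hm]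
  simp [Complex.norm_exp_ofReal_mul_I]

theorem IsDiskAut.measurable {σ : ℂ → ℂ} (hσ : IsDiskAut σ) : Measurable σ := by
  obtain ⟨c, a, -, -, h⟩ := hσ
  rw [funext h]
  fun_prop

theorem exists_mem_Ioc_exp_eq {w : ℂ} (hw : ‖w‖ = 1) :
    ∃ u ∈ Ioc (0 : ℝ) (2 * Real.pi), Complex.exp (u * I) = w := by
  have hper : Function.Periodic (fun t : ℝ => Complex.exp (t * I)) (2 * Real.pi) := fun t => by
    push_cast
    rw [add_mul, Complex.exp_periodic]
  obtain ⟨u, hu, hwu⟩ := hper.exists_mem_Ioc Real.two_pi_pos (arg w) 0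
  refine ⟨u, by simpa using hu, ?_⟩
  rw [← hwu]
  simpa [hw] using Complex.norm_mul_exp_arg_mul_I w

theorem IsDiskAut.quasiMeasurePreserving {σ : ℂ → ℂ} (hσ : IsDiskAut σ) :
    Measure.QuasiMeasurePreserving σ circleMeasure circleMeasure := by
  refine ⟨hσ.measurable, Measure.AbsolutelyContinuous.mk fun E hE hE0 => ?_⟩
  rw [Measure.map_apply hσ.measurable hE, circleMeasure_eq_zero_iff (hσ.measurable hE)]
  rw [circleMeasure_eq_zero_iff hE] at hE0
  obtain ⟨c, a, hc, ha, rfl⟩ := hσ.exists_eq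
  have hc0 : c ≠ 0 := norm_ne_zero_iff.1 (by rw [hc]; exact one_ne_zero)
  set ι : ℝ → ℂ := fun u => -diskMoebius (-a) (c⁻¹ * Complex.exp (u * I)) with hι
  have hι1 : ∀ u : ℝ, ‖c⁻¹ * Complex.exp (u * I)‖ = 1 := fun u => by
    rw [norm_mul, norm_inv, hc, Complex.norm_exp_ofReal_mul_I, inv_one, one_mul]
  have hιd : Differentiable ℝ ι := by
    intro u
    have h1 : DifferentiableAt ℝ (fun u : ℝ => c⁻¹ * Complex.exp (u * I)) u := by fun_prop
    have h2 : DifferentiableAt ℝ (diskMoebius (-a)) (c⁻¹ * Complex.exp (u * I)) :=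
      (differentiableAt_diskMoebius (by rwa [norm_neg]) (hι1 u).le).restrictScalars ℝ
    exact (DifferentiableAt.fun_comp' u h2 h1).neg
  set ψ : ℝ → ℝ := fun u => Real.pi + (Complex.log (ι u)).im with hψ
  set T : Set ℝ := {t : ℝ | Complex.exp (t * I) ∈ E ∧ t ∈ Ioc 0 (2 * Real.pi)} with hT
  have hψd : DifferentiableOn ℝ ψ (T ∩ {u | ι u ∈ slitPlane}) := by
    intro u hu
    have h1 := ((hιd u).hasDerivAt.clog_real hu.2).differentiableAt
    have h2 : DifferentiableAt ℝ (fun u => (Complex.log (ι u)).im) u :=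
      DifferentiableAt.fun_comp' u (Complex.imCLM.differentiableAt) h1
    exact (h2.const_add _).differentiableWithinAt
  have hnull := addHaar_image_eq_zero_of_differentiableOn_of_addHaar_eq_zero volume hψd
    (measure_mono_null inter_subset_left hE0)
  refine measure_mono_null (t := {2 * Real.pi} ∪ ψ '' (T ∩ {u | ι u ∈ slitPlane})) ?_
    (measure_union_null Real.volume_singleton hnull)
  rintro t ⟨htE, ht0, ht1⟩
  rcases ht1.eq_or_lt with rfl | htlt
  · exact Or.inl rfl
  right
  have hn : ‖Complex.exp (t * I)‖ = 1 := Complex.norm_exp_ofReal_mul_I t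
  obtain ⟨u, hu, hue⟩ := exists_mem_Ioc_exp_eq (w := c * diskMoebius a (Complex.exp (t * I)))
    (by rw [norm_mul, hc, one_mul, norm_diskMoebius_eq_one ha hn])
  have hιu : ι u = Complex.exp ((t - Real.pi : ℝ) * I) := by
    rw [hι]
    dsimp only
    rw [hue, inv_mul_cancel_left₀ hc0, diskMoebius_neg_diskMoebius ha hn.le]
    push_cast
    rw [sub_mul, Complex.exp_sub, Complex.exp_pi_mul_I, div_neg, div_one]
  have hmem : t - Real.pi ∈ Ioo (-Real.pi) Real.pi := ⟨by linarith, by linarith⟩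
  have hlog : (Complex.log (ι u)).im = t - Real.pi := by
    rw [hιu, Complex.log_im, Complex.arg_exp_mul_I, toIocMod_eq_self]
    exact ⟨hmem.1, by linarith [hmem.2]⟩
  refine ⟨u, ⟨⟨?_, hu⟩, ?_⟩, ?_⟩
  · rw [hue]
    exact htE
  · rw [mem_ofPred_eq, Complex.mem_slitPlane_iff_arg, ← Complex.log_im, hlog]
    exact ⟨by linarith [hmem.2], by rw [hιu]; exact Complex.exp_ne_zero _⟩
  · rw [hψ]
    dsimp only
    rw [hlog]
    ring

/-- A nontangential limit is a limit along any curve in a Stolz region. -/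
theorem NTLim.tendsto_comp {g : ℂ → ℂ} {ζ L : ℂ} (h : NTLim (ball 0 1) g ζ L) {l : Filter ℝ}
    {p : ℝ → ℂ} (hp : Tendsto p l (𝓝 ζ)) (hball : ∀ᶠ r in l, p r ∈ ball (0 : ℂ) 1) {K : ℝ}
    (hK : ∀ᶠ r in l, ‖p r - ζ‖ ≤ K * (1 - ‖p r‖)) : Tendsto (fun r => g (p r)) l (𝓝 L) := by
  refine (h (max K 1 + 1) (by linarith [le_max_right K 1])).comp
    (tendsto_nhdsWithin_iff.2 ⟨hp, ?_⟩)
  filter_upwards [hball, hK] with r hr hKr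
  refine ⟨hr, ?_⟩
  have hr1 : ‖p r‖ < 1 := mem_ball_zero_iff.1 hr
  have hdist : 1 - ‖p r‖ ≤ infDist (p r) (ball (0 : ℂ) 1)ᶜ := by
    refine (le_infDist ⟨1, by simp⟩).2 fun y hy => ?_
    have hy1 : 1 ≤ ‖y‖ := not_lt.1 fun h => hy (mem_ball_zero_iff.2 h)
    have := norm_sub_norm_le y (p r)
    rw [dist_comm, dist_eq_norm]
    linarith
  have hpos : 0 < 1 - ‖p r‖ := by linarith
  calc ‖p r - ζ‖ ≤ K * (1 - ‖p r‖) := hKr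
    _ ≤ max K 1 * (1 - ‖p r‖) := by gcongr; exact le_max_left _ _
    _ < (max K 1 + 1) * (1 - ‖p r‖) := by linarith
    _ ≤ (max K 1 + 1) * infDist (p r) (ball (0 : ℂ) 1)ᶜ := by
      have := le_max_right K 1
      gcongr

/-- The image of a radius under a disk automorphism approaches the circle nontangentially. -/
theorem NTLim.tendsto_diskAut {g σ : ℂ → ℂ} (hσ : IsDiskAut σ) {ζ L : ℂ} (hζ : ‖ζ‖ = 1)
    (h : NTLim (ball 0 1) g (σ ζ) L) :
    Tendsto (fun r : ℝ => g (σ (r * ζ))) (𝓝[<] 1) (𝓝 L) := by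
  have hmul : Tendsto (fun r : ℝ => (r : ℂ) * ζ) (𝓝[<] 1) (𝓝 ζ) := by
    have hc : Continuous fun r : ℝ => (r : ℂ) * ζ := by fun_prop
    simpa using (hc.tendsto 1).mono_left nhdsWithin_le_nhds
  have hd := hσ.differentiableAt hζ.le
  have hpos : ∀ᶠ r : ℝ in 𝓝[<] 1, r ∈ Ioo (0 : ℝ) 1 := Ioo_mem_nhdsLT one_pos
  have hnorm : ∀ r ∈ Ioo (0 : ℝ) 1, ‖(r : ℂ) * ζ‖ = r := fun r hr => by
    rw [norm_mul, hζ, mul_one, Complex.norm_real, Real.norm_of_nonneg hr.1.le]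
  have hball : ∀ r ∈ Ioo (0 : ℝ) 1, (r : ℂ) * ζ ∈ ball (0 : ℂ) 1 := fun r hr => by
    rw [mem_ball_zero_iff, hnorm r hr]
    exact hr.2
  obtain ⟨C, hC0, hC⟩ := hd.isBigO_sub.exists_nonneg
  obtain ⟨c, a, hc, ha, hσeq⟩ := hσ.exists_eq
  have ha0 : 0 < 1 - ‖a‖ ^ 2 := by nlinarith [norm_nonneg a]
  refine h.tendsto_comp (hd.continuousAt.tendsto.comp hmul)
    (hpos.mono fun r hr => hσ.mapsTo_ball (hball r hr)) (K := C * (8 / (1 - ‖a‖ ^ 2))) ?_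
  filter_upwards [hpos, hmul.eventually hC.bound] with r hr hCr
  have hrn := hnorm r hr
  have h1 : ‖(r : ℂ) * ζ - ζ‖ = 1 - r := by
    rw [← sub_one_mul, norm_mul, hζ, mul_one, ← Complex.ofReal_one, ← Complex.ofReal_sub,
      Complex.norm_real, Real.norm_eq_abs, abs_sub_comm, abs_of_nonneg (by linarith [hr.2])]
  have h2 : 1 - r ≤ 8 / (1 - ‖a‖ ^ 2) * (1 - ‖σ (r * ζ)‖) := by
    have hs1 : ‖σ (r * ζ)‖ < 1 := mem_ball_zero_iff.1 (hσ.mapsTo_ball (hball r hr))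
    have hs : ‖σ (r * ζ)‖ = ‖diskMoebius a (r * ζ)‖ := by rw [hσeq, norm_mul, hc, one_mul]
    have hle : ‖(r : ℂ) * ζ‖ ≤ 1 := hrn.trans_le hr.2.le
    have hid := one_sub_norm_diskMoebius_sq ha hle
    rw [← hs, hrn] at hid
    have hden : ‖1 - (starRingEnd ℂ) a * (r * ζ)‖ ≤ 2 := by
      refine (norm_sub_le _ _).trans ?_
      rw [norm_one, norm_mul, RCLike.norm_conj]
      nlinarith [norm_nonneg a, norm_nonneg ((r : ℂ) * ζ)]
    have hden0 : 0 < ‖1 - (starRingEnd ℂ) a * (r * ζ)‖ :=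
      norm_pos_iff.2 (diskMoebius_denom_ne_zero ha hle)
    have h3 : (1 - ‖a‖ ^ 2) * (1 - r ^ 2) / 4 ≤ 1 - ‖σ (r * ζ)‖ ^ 2 := by
      rw [hid]
      have : 0 ≤ 1 - r ^ 2 := by nlinarith [hr.1, hr.2]
      gcongr
      nlinarith
    have h4 : 1 - ‖σ (r * ζ)‖ ^ 2 ≤ 2 * (1 - ‖σ (r * ζ)‖) := by
      nlinarith [norm_nonneg (σ (r * ζ))]
    rw [div_mul_eq_mul_div, le_div_iff₀ ha0]
    nlinarith [hr.1, hr.2]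
  calc ‖σ (r * ζ) - σ ζ‖ ≤ C * (1 - r) := by rw [← h1]; exact hCr
    _ ≤ C * (8 / (1 - ‖a‖ ^ 2) * (1 - ‖σ (r * ζ)‖)) := by gcongr
    _ = _ := by ring

theorem isDiskAut_id : IsDiskAut fun z => z :=
  ⟨1, 0, norm_one, by simp, fun z => by simp⟩

theorem NTLim.tendsto_radial {g : ℂ → ℂ} {ζ L : ℂ} (hζ : ‖ζ‖ = 1)
    (h : NTLim (ball 0 1) g ζ L) : Tendsto (fun r : ℝ => g (r * ζ)) (𝓝[<] 1) (𝓝 L) :=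
  h.tendsto_diskAut isDiskAut_id hζ

/- STATEMENT 4: A measurable function F on the unit circle 𝕋 has the form F = f ∘ τ
for some measurable f on Γ iff F ∘ σ = F (m-a.e.) for every σ in the covering group
𝔊 of τ. -/
theorem factors_through_tau_iff_deck_invariant {n : ℕ} (D : MCDomain n)
    (τ τb : ℂ → ℂ) (hτ : IsCoveringOfDisk D.Ω D.w₀ τ) (hτb : IsBoundaryMap D.Ω τ τb) :
    ∀ F : ℂ → ℂ, Measurable F →
      ((∃ f : ℂ → ℂ, Measurable f ∧ F =ᵐ[circleMeasure] fun ζ => f (τb ζ)) ↔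
        ∀ σ : ℂ → ℂ, IsDeck τ σ → (fun ζ => F (σ ζ)) =ᵐ[circleMeasure] F) := by
  intro F hF
  constructor
  · rintro ⟨f, -, hFf⟩ σ hσ
    have hq := hσ.1.quasiMeasurePreserving
    filter_upwards [hFf, hq.ae hFf, hτb.2, hq.ae hτb.2, ae_norm_eq_one]
      with ζ h₁ h₂ hlim hlimσ hζ
    have hrad := hlim.1.tendsto_radial hζ
    have hradσ : Tendsto (fun r : ℝ => τ (r * ζ)) (𝓝[<] 1) (𝓝 (τb (σ ζ))) := by
      refine (hlimσ.1.tendsto_diskAut hσ.1 hζ).congr' ?_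
      filter_upwards [Ioo_mem_nhdsLT one_pos] with r hr
      refine hσ.2 _ (mem_ball_zero_iff.2 ?_)
      rw [norm_mul, hζ, mul_one, Complex.norm_real, Real.norm_of_nonneg hr.1.le]
      exact hr.2
    rw [h₁, h₂, tendsto_nhds_unique hrad hradσ]
  · intro hinv
    obtain ⟨S, hSc, hS, htrans⟩ := hτ.exists_countable_isDeck
    obtain ⟨g, hg, hsel⟩ := hτ.exists_measurable_selector hS htrans
    refine ⟨F ∘ g, hF.comp hg, ?_⟩
    have hall : ∀ᵐ ζ ∂circleMeasure, ∀ σ ∈ S, F (σ ζ) = F ζ :=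
      (ae_ball_iff hSc).2 fun σ hσ => hinv σ (hS σ hσ)
    filter_upwards [hall, hτb.2, ae_norm_eq_one] with ζ hζS hlim hζ
    obtain ⟨σ, hσ, hσζ⟩ := hsel ζ (τb ζ) hζ hlim.2 (hlim.1.tendsto_radial hζ)
    rw [Function.comp_apply, ← hσζ, hζS σ hσ]
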